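/- arXiv:2508.04813 — 3 statements merged into one kernel-verified Lean document; each statement's English description precedes it below -/
import Mathlib

section
/- Let d ≥ 2 be an integer and let (F₁,F₂,F₃) and (G₁,G₂,G₃) be two triples of complete flags in ℂ^d, each in general position. Then (F₁,F₂,F₃) and (G₁,G₂,G₃) are projectively equivalent if and only if T^j(F₁,F₂,F₃) = T^j(G₁,G₂,G₃) for every j ∈ ℬ. -/
open scoped BigOperators

/-- A complete flag in `ℂ^d`, recorded by its chain of subspaces
`{0} = F^0 ⊆ F^1 ⊆ ⋯ ⊆ F^d = ℂ^d` with `dim F^k = k` (the values for `k > d` are `⊤`). -/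
structure CompleteFlag (d : ℕ) where
  space : ℕ → Submodule ℂ (Fin d → ℂ)
  mono : Monotone space
  finrank_eq : ∀ k, k ≤ d → Module.finrank ℂ (space k) = k
  eq_top : ∀ k, d ≤ k → space k = ⊤

/-- A tuple of complete flags is in general position if
`F₁^{k₁} + ⋯ + F_m^{k_m} = ℂ^d` whenever `k₁ + ⋯ + k_m = d`. -/
def GenPos {d m : ℕ} (F : Fin m → CompleteFlag d) : Prop :=
  ∀ k : Fin m → ℕ, (∑ i, k i) = d → (⨆ i, (F i).space (k i)) = ⊤

/-- The exterior algebra of `ℂ^d`. -/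
abbrev ExtAlg (d : ℕ) := ExteriorAlgebra ℂ (Fin d → ℂ)

/-- The image of `⋀^k (F^k)` inside the exterior algebra of `ℂ^d`. -/
noncomputable def flagPower {d : ℕ} (F : CompleteFlag d) (k : ℕ) : Submodule ℂ (ExtAlg d) :=
  (Submodule.map (ExteriorAlgebra.ι ℂ) (F.space k)) ^ k

/-- The top exterior power `⋀^d (ℂ^d)` inside the exterior algebra. -/
noncomputable def topPower (d : ℕ) : Submodule ℂ (ExtAlg d) :=
  (LinearMap.range (ExteriorAlgebra.ι ℂ : (Fin d → ℂ) →ₗ[ℂ] ExtAlg d)) ^ d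

/-- A linear functional realizing a fixed isomorphism `⋀^d (ℂ^d) ≅ ℂ`,
i.e. injective on the top exterior power. -/
def IsTopIso {d : ℕ} (φ : ExtAlg d →ₗ[ℂ] ℂ) : Prop :=
  ∀ x ∈ topPower d, φ x = 0 → x = 0

/-- A choice, for each `k ≤ d`, of a nonzero element `f^k ∈ ⋀^k (F^k)`. -/
def IsFlagChoice {d : ℕ} (F : CompleteFlag d) (f : ℕ → ExtAlg d) : Prop :=
  ∀ k, k ≤ d → f k ∈ flagPower F k ∧ f k ≠ 0

/-- A canonical choice of a nonzero element of `⋀^k (F^k)`. -/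
noncomputable def flagElt {d : ℕ} (F : CompleteFlag d) (k : ℕ) : ExtAlg d :=
  open scoped Classical in
  if h : ∃ x, x ∈ flagPower F k ∧ x ≠ 0 then h.choose else 0

/-- The triple ratio computed from given choices `f₁, f₂, f₃` of elements. -/
noncomputable def tripleRatioOf {d : ℕ} (φ : ExtAlg d →ₗ[ℂ] ℂ) (f₁ f₂ f₃ : ℕ → ExtAlg d)
    (j : ℕ × ℕ × ℕ) : ℂ :=
  (φ (f₁ (j.1 + 1) * f₂ j.2.1 * f₃ (j.2.2 - 1)) *
   φ (f₁ j.1 * f₂ (j.2.1 - 1) * f₃ (j.2.2 + 1)) *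
   φ (f₁ (j.1 - 1) * f₂ (j.2.1 + 1) * f₃ j.2.2)) /
  (φ (f₁ (j.1 - 1) * f₂ j.2.1 * f₃ (j.2.2 + 1)) *
   φ (f₁ j.1 * f₂ (j.2.1 + 1) * f₃ (j.2.2 - 1)) *
   φ (f₁ (j.1 + 1) * f₂ (j.2.1 - 1) * f₃ j.2.2))

/-- The `j`-triple ratio `T^j(F₁,F₂,F₃)`. -/
noncomputable def tripleRatio {d : ℕ} (φ : ExtAlg d →ₗ[ℂ] ℂ) (F₁ F₂ F₃ : CompleteFlag d)
    (j : ℕ × ℕ × ℕ) : ℂ :=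
  tripleRatioOf φ (flagElt F₁) (flagElt F₂) (flagElt F₃) j

/-- The double ratio computed from given choices of elements. -/
noncomputable def doubleRatioOf {d : ℕ} (φ : ExtAlg d →ₗ[ℂ] ℂ) (g₁ g₂ h₁ h₂ : ℕ → ExtAlg d)
    (i : ℕ × ℕ) : ℂ :=
  -((φ (g₁ i.1 * g₂ (i.2 - 1) * h₁ 1) * φ (g₁ (i.1 - 1) * g₂ i.2 * h₂ 1)) /
    (φ (g₁ i.1 * g₂ (i.2 - 1) * h₂ 1) * φ (g₁ (i.1 - 1) * g₂ i.2 * h₁ 1)))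

/-- The `i`-double ratio `D^i(G₁,G₂,H₁,H₂)`. -/
noncomputable def doubleRatio {d : ℕ} (φ : ExtAlg d →ₗ[ℂ] ℂ) (G₁ G₂ H₁ H₂ : CompleteFlag d)
    (i : ℕ × ℕ) : ℂ :=
  doubleRatioOf φ (flagElt G₁) (flagElt G₂) (flagElt H₁) (flagElt H₂) i

/-- `𝒜`: pairs of positive integers summing to `d`. -/
def Aset (d : ℕ) : Finset (ℕ × ℕ) :=
  (Finset.range (d + 1) ×ˢ Finset.range (d + 1)).filter
    fun i => 0 < i.1 ∧ 0 < i.2 ∧ i.1 + i.2 = d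

/-- `ℬ`: triples of positive integers summing to `d`. -/
def Bset (d : ℕ) : Finset (ℕ × ℕ × ℕ) :=
  (Finset.range (d + 1) ×ˢ Finset.range (d + 1) ×ˢ Finset.range (d + 1)).filter
    fun j => 0 < j.1 ∧ 0 < j.2.1 ∧ 0 < j.2.2 ∧ j.1 + j.2.1 + j.2.2 = d


namespace TripleProof

/-- The `k`-th exterior power of a subspace inside the exterior algebra. -/
noncomputable def pw {d : ℕ} (W : Submodule ℂ (Fin d → ℂ)) (k : ℕ) : Submodule ℂ (ExtAlg d) :=
  (Submodule.map (ExteriorAlgebra.ι ℂ) W) ^ k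

lemma map_pw {d : ℕ} (A : (Fin d → ℂ) →ₗ[ℂ] (Fin d → ℂ)) (W : Submodule ℂ (Fin d → ℂ)) (k : ℕ) :
    (pw W k).map (ExteriorAlgebra.map A).toLinearMap = pw (W.map A) k := by
  unfold pw
  rw [Submodule.map_pow, ← Submodule.map_comp, ExteriorAlgebra.map_comp_ι, Submodule.map_comp]

lemma finrank_pw {d : ℕ} (W : Submodule ℂ (Fin d → ℂ)) (k : ℕ) :
    Module.finrank ℂ (pw W k) = Nat.choose (Module.finrank ℂ W) k := by
  have h : pw W k = (⋀[ℂ]^k W).map (ExteriorAlgebra.map W.subtype).toLinearMap := by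
    unfold pw ExteriorAlgebra.exteriorPower
    rw [Submodule.map_pow, LinearMap.range_eq_map, ← Submodule.map_comp,
      ExteriorAlgebra.map_comp_ι, Submodule.map_comp]
    simp
  have hinj : Function.Injective (ExteriorAlgebra.map W.subtype).toLinearMap :=
    ExteriorAlgebra.map_injective_field (by simp)
  rw [h, ← (Submodule.equivMapOfInjective _ hinj _).finrank_eq]
  exact exteriorPower.finrank_eq ℂ k

lemma topPower_eq {d : ℕ} : topPower d = pw (⊤ : Submodule ℂ (Fin d → ℂ)) d := by
  unfold topPower pw; rw [LinearMap.range_eq_map]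

instance {d : ℕ} (W : Submodule ℂ (Fin d → ℂ)) (k : ℕ) : Module.Finite ℂ (pw W k) := by
  rw [Module.Finite.iff_fg]
  exact Submodule.FG.pow (Submodule.FG.map _ (IsNoetherian.noetherian W)) k

lemma pw_eq_zero {d : ℕ} {W : Submodule ℂ (Fin d → ℂ)} {k : ℕ} (h : Module.finrank ℂ W < k) :
    pw W k = 0 := by
  have := finrank_pw W k
  rw [Nat.choose_eq_zero_of_lt h] at this
  exact Submodule.finrank_eq_zero.mp this

lemma pw_ne_bot {d : ℕ} {W : Submodule ℂ (Fin d → ℂ)} {k : ℕ} (h : Module.finrank ℂ W = k) :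
    pw W k ≠ ⊥ := by
  intro h0
  have := finrank_pw W k
  rw [h0, h] at this
  simp at this

lemma pw_eq_span {d : ℕ} {W : Submodule ℂ (Fin d → ℂ)} {k : ℕ} (h : Module.finrank ℂ W = k)
    {x : ExtAlg d} (hx : x ∈ pw W k) (h0 : x ≠ 0) : Submodule.span ℂ {x} = pw W k := by
  apply Submodule.eq_of_le_of_finrank_eq
  · rwa [Submodule.span_singleton_le_iff_mem]
  · rw [finrank_span_singleton h0, finrank_pw, h, Nat.choose_self]

lemma commute_map {d : ℕ} (A B : Submodule ℂ (Fin d → ℂ)) :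
    Commute (Submodule.map (ExteriorAlgebra.ι ℂ) A) (Submodule.map (ExteriorAlgebra.ι ℂ) B) := by
  have key : ∀ A B : Submodule ℂ (Fin d → ℂ), 
      Submodule.map (ExteriorAlgebra.ι ℂ) A * Submodule.map (ExteriorAlgebra.ι ℂ) B ≤
      Submodule.map (ExteriorAlgebra.ι ℂ) B * Submodule.map (ExteriorAlgebra.ι ℂ) A := by
    intro A B
    rw [Submodule.mul_le]
    rintro _ ⟨a, ha, rfl⟩ _ ⟨b, hb, rfl⟩
    have := ExteriorAlgebra.ι_add_mul_swap (R := ℂ) a b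
    rw [eq_neg_of_add_eq_zero_left this]
    exact Submodule.neg_mem _ (Submodule.mul_mem_mul ⟨b, hb, rfl⟩ ⟨a, ha, rfl⟩)
  exact le_antisymm (key A B) (key B A)

lemma pw_sup {d : ℕ} {A B : Submodule ℂ (Fin d → ℂ)} {p q : ℕ}
    (hA : Module.finrank ℂ A ≤ p) (hB : Module.finrank ℂ B ≤ q) :
    pw (A ⊔ B) (p + q) = pw A p * pw B q := by
  have h1 : pw (A ⊔ B) (p + q) = (Submodule.map (ExteriorAlgebra.ι ℂ) A +
      Submodule.map (ExteriorAlgebra.ι ℂ) B) ^ (p + q) := by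
    unfold pw; rw [Submodule.map_sup]; rfl
  rw [h1, (commute_map A B).add_pow, Finset.sum_eq_single p]
  · rw [Nat.add_sub_cancel_left, ← Nat.cast_comm, ← nsmul_eq_mul, nsmul_eq_self]
    · rfl
    · exact (Nat.choose_pos (Nat.le_add_right _ _)).ne'
  · intro m hm hmp
    rcases lt_or_gt_of_ne hmp with h | h
    · have := pw_eq_zero (W := B) (k := p + q - m) (by omega)
      unfold pw at this
      rw [this]; simp
    · have := pw_eq_zero (W := A) (k := m) (by omega)
      unfold pw at this
      rw [this]; simp
  · intro h; simp at h

lemma span_mul_pw {d : ℕ} {A B : Submodule ℂ (Fin d → ℂ)} {p q : ℕ} {x y : ExtAlg d}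
    (hA : Module.finrank ℂ A ≤ p) (hB : Module.finrank ℂ B ≤ q)
    (hx : Submodule.span ℂ {x} = pw A p) (hy : Submodule.span ℂ {y} = pw B q) :
    Submodule.span ℂ {x * y} = pw (A ⊔ B) (p + q) := by
  rw [pw_sup hA hB, ← hx, ← hy, Submodule.span_mul_span, Set.singleton_mul_singleton]

lemma finrank_sup_le {d : ℕ} {A B : Submodule ℂ (Fin d → ℂ)} {p q : ℕ}
    (hA : Module.finrank ℂ A ≤ p) (hB : Module.finrank ℂ B ≤ q) :
    Module.finrank ℂ (A ⊔ B : Submodule ℂ (Fin d → ℂ)) ≤ p + q :=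
  (Submodule.finrank_add_le_finrank_add_finrank A B).trans (by omega)

lemma span_ι {d : ℕ} (y : Fin d → ℂ) :
    Submodule.span ℂ {ExteriorAlgebra.ι ℂ y} = pw (Submodule.span ℂ {y}) 1 := by
  unfold pw; rw [pow_one, Submodule.map_span, Set.image_singleton]

lemma finrank_span_le_one {d : ℕ} (y : Fin d → ℂ) :
    Module.finrank ℂ (Submodule.span ℂ {y}) ≤ 1 := by
  simpa using finrank_span_le_card (R := ℂ) ({y} : Set (Fin d → ℂ))

lemma span_flagElt {d : ℕ} (F : CompleteFlag d) {k : ℕ} (hk : k ≤ d) :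
    Submodule.span ℂ {flagElt F k} = pw (F.space k) k := by
  have hne : ∃ x, x ∈ flagPower F k ∧ x ≠ 0 := by
    obtain ⟨x, hx, h0⟩ := Submodule.exists_mem_ne_zero_of_ne_bot (pw_ne_bot (F.finrank_eq k hk))
    exact ⟨x, hx, h0⟩
  have : flagElt F k ∈ flagPower F k ∧ flagElt F k ≠ 0 := by
    unfold flagElt
    rw [dif_pos hne]; exact hne.choose_spec
  exact pw_eq_span (F.finrank_eq k hk) this.1 this.2

lemma flagElt_congr {d : ℕ} {F G : CompleteFlag d} {k : ℕ} (h : F.space k = G.space k) :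
    flagElt F k = flagElt G k := by
  have : flagPower F k = flagPower G k := by unfold flagPower; rw [h]
  unfold flagElt
  generalize flagPower F k = P at this ⊢
  subst this
  rfl

lemma φ_ne {d : ℕ} {φ : ExtAlg d →ₗ[ℂ] ℂ} (hφ : IsTopIso φ) {x : ExtAlg d} 
    {W : Submodule ℂ (Fin d → ℂ)} (hW : W = ⊤)
    (hx : Submodule.span ℂ {x} = pw W d) : φ x ≠ 0 := by
  subst hW
  intro h
  have h1 : x ∈ topPower d := by
    rw [topPower_eq, ← hx]; exact Submodule.mem_span_singleton_self x
  have h2 := hφ x h1 h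
  rw [h2, Submodule.span_zero_singleton] at hx
  exact pw_ne_bot (by simp) hx.symm

lemma gp_sup {d : ℕ} {F₁ F₂ F₃ : CompleteFlag d} (hF : GenPos ![F₁, F₂, F₃]) {a b c : ℕ}
    (h : a + b + c = d) : F₁.space a ⊔ F₂.space b ⊔ F₃.space c = ⊤ := by
  have := hF ![a, b, c] (by simp [Fin.sum_univ_three, h])
  rw [eq_top_iff, ← this]
  apply iSup_le
  intro i
  fin_cases i
  · exact le_sup_of_le_left le_sup_left
  · exact le_sup_of_le_left le_sup_right
  · exact le_sup_right

lemma span_triple {d : ℕ} (F₁ F₂ F₃ : CompleteFlag d) {a b c : ℕ} (ha : a ≤ d)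
    (hb : b ≤ d) (hc : c ≤ d) :
    Submodule.span ℂ {flagElt F₁ a * flagElt F₂ b * flagElt F₃ c} =
      pw (F₁.space a ⊔ F₂.space b ⊔ F₃.space c) (a + b + c) := by
  have h1 := (F₁.finrank_eq a ha).le
  have h2 := (F₂.finrank_eq b hb).le
  have h3 := (F₃.finrank_eq c hc).le
  exact span_mul_pw (finrank_sup_le h1 h2) h3
    (span_mul_pw h1 h2 (span_flagElt _ ha) (span_flagElt _ hb)) (span_flagElt _ hc)

lemma triple_ne {d : ℕ} {φ : ExtAlg d →ₗ[ℂ] ℂ} (hφ : IsTopIso φ) {F₁ F₂ F₃ : CompleteFlag d}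
    (hF : GenPos ![F₁, F₂, F₃]) {a b c : ℕ} (h : a + b + c = d) :
    φ (flagElt F₁ a * flagElt F₂ b * flagElt F₃ c) ≠ 0 := by
  have := span_triple F₁ F₂ F₃ (a := a) (b := b) (c := c) (by omega) (by omega) (by omega)
  rw [h] at this
  exact φ_ne hφ (gp_sup hF h) this

lemma mem_of_wedge_zero {d : ℕ} {φ : ExtAlg d →ₗ[ℂ] ℂ} (hφ : IsTopIso φ)
    {F₁ F₂ F₃ : CompleteFlag d} (hF : GenPos ![F₁, F₂, F₃]) {a b c : ℕ} (h : a + b + c + 1 = d)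
    {y : Fin d → ℂ} 
    (hy : φ (flagElt F₁ a * flagElt F₂ b * flagElt F₃ c * ExteriorAlgebra.ι ℂ y) = 0) :
    y ∈ F₁.space a ⊔ F₂.space b ⊔ F₃.space c := by
  by_contra hn
  have h1 := (F₁.finrank_eq a (by omega)).le
  have h2 := (F₂.finrank_eq b (by omega)).le
  have h3 := (F₃.finrank_eq c (by omega)).le
  have hX := finrank_sup_le (finrank_sup_le h1 h2) h3
  have hs := span_mul_pw hX (finrank_span_le_one y)
    (span_triple F₁ F₂ F₃ (a := a) (b := b) (c := c) (by omega) (by omega) (by omega)) (span_ι y)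
  rw [h] at hs
  refine φ_ne hφ ?_ hs hy
  set X := F₁.space a ⊔ F₂.space b ⊔ F₃.space c with hXdef
  have hge : d ≤ Module.finrank ℂ X + 1 := by
    have e := gp_sup hF (a := a) (b := b) (c := c + 1) (by omega)
    have e3 := (F₃.finrank_eq (c + 1) (by omega))
    have e4 := (F₃.finrank_eq c (by omega))
    have e5 := Submodule.finrank_sup_add_finrank_inf_eq X (F₃.space (c + 1))
    have e6 : X ⊔ F₃.space (c + 1) = ⊤ := by
      rw [eq_top_iff, ← e]
      exact sup_le_sup le_sup_left le_rfl
    have e7 : F₃.space c ≤ X ⊓ F₃.space (c + 1) :=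
      le_inf le_sup_right (F₃.mono (Nat.le_succ c))
    have e8 := Submodule.finrank_mono e7
    rw [e6] at e5
    simp only [finrank_top, Module.finrank_fin_fun] at e5
    omega
  have hlt : X < X ⊔ Submodule.span ℂ {y} := by
    refine lt_of_le_of_ne le_sup_left ?_
    intro he
    apply hn
    rw [he]
    exact Submodule.mem_sup_right (Submodule.mem_span_singleton_self y)
  have := Submodule.finrank_lt_finrank_of_lt hlt
  apply Submodule.eq_top_of_finrank_eq
  have h9 := Submodule.finrank_le (X ⊔ Submodule.span ℂ {y})
  simp only [Module.finrank_fin_fun] at h9 ⊢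
  omega

lemma space_succ {d : ℕ} (F : CompleteFlag d) {c : ℕ} (hc : c < d) {x : Fin d → ℂ}
    (hx : x ∈ F.space (c + 1)) (hn : x ∉ F.space c) :
    F.space (c + 1) = F.space c ⊔ Submodule.span ℂ {x} := by
  symm
  apply Submodule.eq_of_le_of_finrank_le
  · refine sup_le (F.mono (Nat.le_succ c)) ?_
    rwa [Submodule.span_singleton_le_iff_mem]
  · have hlt : F.space c < F.space c ⊔ Submodule.span ℂ {x} := by
      refine lt_of_le_of_ne le_sup_left ?_
      intro he
      apply hn
      rw [he]
      exact Submodule.mem_sup_right (Submodule.mem_span_singleton_self x)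
    have := Submodule.finrank_lt_finrank_of_lt hlt
    rw [F.finrank_eq c hc.le] at this
    rw [F.finrank_eq (c + 1) hc]
    omega

lemma exists_new {d : ℕ} (F : CompleteFlag d) {c : ℕ} (hc : c < d) :
    ∃ x ∈ F.space (c + 1), x ∉ F.space c := by
  by_contra! h
  have h1 : F.space (c + 1) ≤ F.space c := h
  have := Submodule.finrank_mono h1
  rw [F.finrank_eq c hc.le, F.finrank_eq (c + 1) hc] at this
  omega

lemma flagElt_succ {d : ℕ} (F : CompleteFlag d) {c : ℕ} (hc : c < d) :
    ∃ x, F.space (c + 1) = F.space c ⊔ Submodule.span ℂ {x} ∧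
      flagElt F (c + 1) = flagElt F c * ExteriorAlgebra.ι ℂ x := by
  obtain ⟨x, hx, hn⟩ := exists_new F hc
  have hs := space_succ F hc hx hn
  have h1 := span_mul_pw (F.finrank_eq c hc.le).le (finrank_span_le_one x)
    (span_flagElt F hc.le) (span_ι x)
  rw [← hs, ← span_flagElt F hc, Submodule.span_singleton_eq_span_singleton] at h1
  obtain ⟨z, hz⟩ := h1
  refine ⟨(z : ℂ) • x, ?_, ?_⟩
  · rw [hs, Submodule.span_singleton_smul_eq z.isUnit]
  · rw [← hz, map_smul, mul_smul_comm]; rfl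

lemma tripleRatio_eq_of_scale {d : ℕ} {φ : ExtAlg d →ₗ[ℂ] ℂ} {F₁ F₂ F₃ G₁ G₂ G₃ : CompleteFlag d}
    (α β γ : ℕ → ℂ) (δ : ℂ) (hα : ∀ k, α k ≠ 0) (hβ : ∀ k, β k ≠ 0) (hγ : ∀ k, γ k ≠ 0)
    (hδ : δ ≠ 0)
    (h : ∀ a b c, a + b + c = d → φ (flagElt G₁ a * flagElt G₂ b * flagElt G₃ c) =
      α a * β b * γ c * δ * φ (flagElt F₁ a * flagElt F₂ b * flagElt F₃ c))
    {j : ℕ × ℕ × ℕ} (hj : j ∈ Bset d) : tripleRatio φ F₁ F₂ F₃ j = tripleRatio φ G₁ G₂ G₃ j := by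
  obtain ⟨a, b, c⟩ := j
  simp only [Bset, Finset.mem_filter] at hj
  obtain ⟨-, ha, hb, hc, hs⟩ := hj
  unfold tripleRatio tripleRatioOf
  simp only
  rw [h (a + 1) b (c - 1) (by omega), h a (b - 1) (c + 1) (by omega), h (a - 1) (b + 1) c (by omega),
    h (a - 1) b (c + 1) (by omega), h a (b + 1) (c - 1) (by omega), h (a + 1) (b - 1) c (by omega)]
  have hK : (α (a + 1) * α a * α (a - 1)) * (β (b + 1) * β b * β (b - 1)) *
    (γ (c + 1) * γ c * γ (c - 1)) * δ ^ 3 ≠ 0 := by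
    simp [hα, hβ, hγ, hδ]
  rw [← mul_div_mul_left _ _ hK]
  congr 1 <;> ring

lemma exists_scale {d : ℕ} {F G : CompleteFlag d} {A : (Fin d → ℂ) →ₗ[ℂ] (Fin d → ℂ)}
    (h : ∀ k, (F.space k).map A = G.space k) :
    ∃ α : ℕ → ℂ, (∀ k, α k ≠ 0) ∧
      ∀ k ≤ d, flagElt G k = α k • ExteriorAlgebra.map A (flagElt F k) := by
  have : ∀ k, ∃ z : ℂ, z ≠ 0 ∧ (k ≤ d → flagElt G k = z • ExteriorAlgebra.map A (flagElt F k)) := by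
    intro k
    by_cases hk : k ≤ d
    · have h1 := span_flagElt G hk
      rw [← h, ← map_pw, ← span_flagElt F hk, Submodule.map_span, Set.image_singleton, eq_comm,
        Submodule.span_singleton_eq_span_singleton] at h1
      obtain ⟨z, hz⟩ := h1
      exact ⟨z, z.ne_zero, fun _ => hz.symm⟩
    · exact ⟨1, one_ne_zero, fun h => absurd h hk⟩
  choose α h1 h2 using this
  exact ⟨α, h1, h2⟩

lemma top_scale {d : ℕ} {φ : ExtAlg d →ₗ[ℂ] ℂ} (hφ : IsTopIso φ)
    (A : (Fin d → ℂ) ≃ₗ[ℂ] (Fin d → ℂ)) :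
    ∃ δ : ℂ, δ ≠ 0 ∧ ∀ x ∈ topPower d,
      φ (ExteriorAlgebra.map (A : (Fin d → ℂ) →ₗ[ℂ] (Fin d → ℂ)) x) = δ * φ x := by
  have ht : Module.finrank ℂ (⊤ : Submodule ℂ (Fin d → ℂ)) = d := by simp
  obtain ⟨ω, hω, h0⟩ := Submodule.exists_mem_ne_zero_of_ne_bot (pw_ne_bot ht)
  have hs := pw_eq_span ht hω h0
  have h1 := φ_ne hφ rfl hs
  have hs2 : Submodule.span ℂ {ExteriorAlgebra.map (A : (Fin d → ℂ) →ₗ[ℂ] (Fin d → ℂ)) ω} =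
      pw (Submodule.map (A : (Fin d → ℂ) →ₗ[ℂ] (Fin d → ℂ)) ⊤) d := by
    rw [← map_pw, ← hs, Submodule.map_span, Set.image_singleton]; rfl
  have h2 := φ_ne hφ (by simp) hs2
  refine ⟨_, div_ne_zero h2 h1, ?_⟩
  intro x hx
  rw [topPower_eq, ← hs, Submodule.mem_span_singleton] at hx
  obtain ⟨s, rfl⟩ := hx
  simp only [map_smul, smul_eq_mul]
  field_simp

lemma ratio_invariant {d : ℕ} {φ : ExtAlg d →ₗ[ℂ] ℂ} (hφ : IsTopIso φ)
    {F₁ F₂ F₃ G₁ G₂ G₃ : CompleteFlag d} (hF : GenPos ![F₁, F₂, F₃])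
    (A : (Fin d → ℂ) ≃ₗ[ℂ] (Fin d → ℂ))
    (h1 : ∀ k, Submodule.map (A : (Fin d → ℂ) →ₗ[ℂ] (Fin d → ℂ)) (F₁.space k) = G₁.space k)
    (h2 : ∀ k, Submodule.map (A : (Fin d → ℂ) →ₗ[ℂ] (Fin d → ℂ)) (F₂.space k) = G₂.space k)
    (h3 : ∀ k, Submodule.map (A : (Fin d → ℂ) →ₗ[ℂ] (Fin d → ℂ)) (F₃.space k) = G₃.space k)
    {j : ℕ × ℕ × ℕ} (hj : j ∈ Bset d) : tripleRatio φ F₁ F₂ F₃ j = tripleRatio φ G₁ G₂ G₃ j := by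
  obtain ⟨α, hα, eα⟩ := exists_scale h1
  obtain ⟨β, hβ, eβ⟩ := exists_scale h2
  obtain ⟨γ, hγ, eγ⟩ := exists_scale h3
  obtain ⟨δ, hδ, eδ⟩ := top_scale hφ A
  refine tripleRatio_eq_of_scale α β γ δ hα hβ hγ hδ ?_ hj
  intro a b c hs
  rw [eα a (by omega), eβ b (by omega), eγ c (by omega)]
  simp only [smul_mul_assoc, mul_smul_comm, ← map_mul, map_smul, smul_eq_mul]
  rw [eδ]
  · ring
  · have := span_triple F₁ F₂ F₃ (a := a) (b := b) (c := c) (by omega) (by omega) (by omega)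
    rw [hs, gp_sup hF hs] at this
    rw [topPower_eq, ← this]
    exact Submodule.mem_span_singleton_self _

lemma mem_W {d : ℕ} {F₁ F₂ F₃ : CompleteFlag d} (hF : GenPos ![F₁, F₂, F₃]) {c m : ℕ}
    (h : m + c + 1 = d) {y : Fin d → ℂ}
    (hy : ∀ a b, a + b = m → y ∈ F₁.space a ⊔ F₂.space b ⊔ F₃.space c) : y ∈ F₃.space c := by
  have z1 : F₁.space 0 = ⊥ := Submodule.finrank_eq_zero.mp (F₁.finrank_eq 0 (Nat.zero_le _))
  have z2 : F₂.space 0 = ⊥ := Submodule.finrank_eq_zero.mp (F₂.finrank_eq 0 (Nat.zero_le _))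
  have key : ∀ b a, a + b = m → y ∈ F₁.space a ⊔ F₃.space c := by
    intro b
    induction b with
    | zero => 
      intro a ha
      have := hy a 0 ha
      rwa [z2, sup_bot_eq] at this
    | succ b ih =>
      intro a ha
      have i1 := ih (a + 1) (by omega)
      have i2 := hy a (b + 1) ha
      rw [sup_right_comm, Submodule.mem_sup] at i2
      obtain ⟨p, hp, q, hq, rfl⟩ := i2
      have hp' : p ∈ F₁.space (a + 1) ⊔ F₃.space c :=
        (sup_le_sup (F₁.mono (Nat.le_succ a)) le_rfl : F₁.space a ⊔ F₃.space c ≤ _) hp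
      have hq' : q ∈ F₁.space (a + 1) ⊔ F₃.space c := by
        simpa using Submodule.sub_mem _ i1 hp'
      have e1 := Submodule.finrank_sup_add_finrank_inf_eq (F₁.space (a + 1) ⊔ F₃.space c)
        (F₂.space (b + 1))
      rw [sup_right_comm, gp_sup hF (by omega)] at e1
      have e2 := finrank_sup_le (F₁.finrank_eq (a + 1) (by omega)).le
        (F₃.finrank_eq c (by omega)).le
      have e3 := F₂.finrank_eq (b + 1) (by omega)
      simp only [finrank_top, Module.finrank_fin_fun] at e1
      have e4 : (F₁.space (a + 1) ⊔ F₃.space c) ⊓ F₂.space (b + 1) = ⊥ := by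
        apply Submodule.finrank_eq_zero.mp; omega
      have : q ∈ (F₁.space (a + 1) ⊔ F₃.space c) ⊓ F₂.space (b + 1) := ⟨hq', hq⟩
      rw [e4, Submodule.mem_bot] at this
      rw [this, add_zero]
      exact hp
  have := key m 0 (by omega)
  rwa [z1, bot_sup_eq] at this

lemma step {d : ℕ} {φ : ExtAlg d →ₗ[ℂ] ℂ} (hφ : IsTopIso φ)
    {F₁ F₂ F₃ G₁ G₂ G₃ : CompleteFlag d} (hF : GenPos ![F₁, F₂, F₃]) (hG : GenPos ![G₁, G₂, G₃])
    (h1 : ∀ k, F₁.space k = G₁.space k) (h2 : ∀ k, F₂.space k = G₂.space k)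
    (hT : ∀ j ∈ Bset d, tripleRatio φ F₁ F₂ F₃ j = tripleRatio φ G₁ G₂ G₃ j)
    {c : ℕ} (hc : 1 ≤ c) (hcd : c < d) (h3 : F₃.space c = G₃.space c)
    (h3' : F₃.space (c - 1) = G₃.space (c - 1)) : F₃.space (c + 1) = G₃.space (c + 1) := by
  obtain ⟨m, hm⟩ : ∃ m, m + c + 1 = d := ⟨d - c - 1, by omega⟩
  have e1 : flagElt G₁ = flagElt F₁ := funext fun k => (flagElt_congr (h1 k)).symm
  have e2 : flagElt G₂ = flagElt F₂ := funext fun k => (flagElt_congr (h2 k)).symm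
  have e3 := flagElt_congr h3
  have e3' := flagElt_congr h3'
  set E : ℕ → ℂ := fun a => φ (flagElt F₁ a * flagElt F₂ (m - a) * flagElt F₃ (c + 1)) with hE
  set E' : ℕ → ℂ := fun a => φ (flagElt F₁ a * flagElt F₂ (m - a) * flagElt G₃ (c + 1)) with hE'
  have n1 : ∀ a ≤ m, E a ≠ 0 := fun a ha => triple_ne hφ hF (by omega)
  have n2 : ∀ a ≤ m, E' a ≠ 0 := fun a ha => by
    simp only [hE', ← e1, ← e2]; exact triple_ne hφ hG (by omega)
  have cross : ∀ a, a + 1 ≤ m → E (a + 1) * E' a = E' (a + 1) * E a := by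
    intro a ha
    have hj : ((a + 1, m - a, c) : ℕ × ℕ × ℕ) ∈ Bset d := by
      simp only [Bset, Finset.mem_filter, Finset.mem_product, Finset.mem_range]
      omega
    have := hT _ hj
    unfold tripleRatio tripleRatioOf at this
    simp only [Nat.add_sub_cancel, e1, e2, ← e3, ← e3'] at this
    have q1 := triple_ne hφ hF (a := a + 1 + 1) (b := m - a) (c := c - 1) (by omega)
    have q2 := triple_ne hφ hF (a := a) (b := m - a + 1) (c := c) (by omega)
    have q3 := triple_ne hφ hF (a := a + 1) (b := m - a + 1) (c := c - 1) (by omega)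
    have q4 := triple_ne hφ hF (a := a + 1 + 1) (b := m - a - 1) (c := c) (by omega)
    have r1 := n1 a (by omega)
    have r2 := n2 a (by omega)
    have s : m - (a + 1) = m - a - 1 := by omega
    simp only [hE, hE', s] at r1 r2 ⊢
    rw [div_eq_div_iff (mul_ne_zero (mul_ne_zero r1 q3) q4) (mul_ne_zero (mul_ne_zero r2 q3) q4)] at this
    generalize φ (flagElt F₁ (a + 1 + 1) * flagElt F₂ (m - a) * flagElt F₃ (c - 1)) = t1 at *
    generalize φ (flagElt F₁ a * flagElt F₂ (m - a + 1) * flagElt F₃ c) = t2 at *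
    generalize φ (flagElt F₁ (a + 1) * flagElt F₂ (m - a + 1) * flagElt F₃ (c - 1)) = t3 at *
    generalize φ (flagElt F₁ (a + 1 + 1) * flagElt F₂ (m - a - 1) * flagElt F₃ c) = t4 at *
    have hK : t1 * t2 * t3 * t4 ≠ 0 :=
      mul_ne_zero (mul_ne_zero (mul_ne_zero q1 q2) q3) q4
    apply mul_left_cancel₀ hK
    linear_combination this
  obtain ⟨t, ht⟩ : ∃ t : ℂ, ∀ a ≤ m, E a = t * E' a := by
    refine ⟨E 0 / E' 0, ?_⟩
    intro a
    induction a with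
    | zero => intro _; field_simp [n2 0 (Nat.zero_le _)]
    | succ a ih =>
      intro ha
      have i1 := ih (by omega)
      have i2 := cross a ha
      apply mul_right_cancel₀ (n2 a (by omega))
      rw [i2, i1]; ring
  obtain ⟨x, hx, ex⟩ := flagElt_succ F₃ hcd
  obtain ⟨x', hx', ex'⟩ := flagElt_succ G₃ hcd
  have hy : x - t • x' ∈ F₃.space c := by
    apply mem_W hF hm
    intro a b hab
    apply mem_of_wedge_zero hφ hF (by omega)
    have := ht a (by omega)
    simp only [hE, hE', ex, ex', ← e3] at this
    have hb : m - a = b := by omega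
    rw [hb] at this
    simp only [← mul_assoc] at this
    rw [map_sub, mul_sub, map_sub, this, map_smul, mul_smul_comm, map_smul, smul_eq_mul, sub_self]
  apply Submodule.eq_of_le_of_finrank_eq
  · rw [hx, hx', ← h3]
    refine sup_le le_sup_left ?_
    rw [Submodule.span_singleton_le_iff_mem]
    have : x = (x - t • x') + t • x' := by abel
    rw [this]
    exact Submodule.add_mem_sup hy (Submodule.smul_mem _ _ (Submodule.mem_span_singleton_self _))
  · rw [F₃.finrank_eq _ (by omega), G₃.finrank_eq _ (by omega)]

lemma all_eq {d : ℕ} {φ : ExtAlg d →ₗ[ℂ] ℂ} (hφ : IsTopIso φ)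
    {F₁ F₂ F₃ G₁ G₂ G₃ : CompleteFlag d} (hF : GenPos ![F₁, F₂, F₃]) (hG : GenPos ![G₁, G₂, G₃])
    (h1 : ∀ k, F₁.space k = G₁.space k) (h2 : ∀ k, F₂.space k = G₂.space k)
    (hT : ∀ j ∈ Bset d, tripleRatio φ F₁ F₂ F₃ j = tripleRatio φ G₁ G₂ G₃ j)
    (h3 : F₃.space 1 = G₃.space 1) (k : ℕ) : F₃.space k = G₃.space k := by
  have z : ∀ F : CompleteFlag d, F.space 0 = ⊥ := fun F =>
    Submodule.finrank_eq_zero.mp (F.finrank_eq 0 (Nat.zero_le _))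
  have key : ∀ k, F₃.space k = G₃.space k ∧ F₃.space (k + 1) = G₃.space (k + 1) := by
    intro k
    induction k with
    | zero => exact ⟨by rw [z, z], h3⟩
    | succ k ih =>
      refine ⟨ih.2, ?_⟩
      by_cases hk : k + 1 < d
      · exact step hφ hF hG h1 h2 hT (by omega) hk ih.2 ih.1
      · rw [F₃.eq_top _ (by omega), G₃.eq_top _ (by omega)]
  exact (key k).1

lemma adapted {d : ℕ} (F : CompleteFlag d) {u : ℕ → Fin d → ℂ}
    (hu : ∀ k < d, u k ∈ F.space (k + 1) ∧ u k ∉ F.space k) :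
    ∀ k ≤ d, F.space k = Submodule.span ℂ (u '' Set.Iio k) := by
  intro k
  induction k with
  | zero =>
    intro _
    rw [Submodule.finrank_eq_zero.mp (F.finrank_eq 0 (Nat.zero_le _))]
    have : Set.Iio (0 : ℕ) = ∅ := by ext; simp
    rw [this]; simp
  | succ k ih =>
    intro hk
    rw [space_succ F hk (hu k hk).1 (hu k hk).2, ih (by omega), ← Submodule.span_union]
    congr 1
    have : Set.Iio (k + 1) = Set.Iio k ∪ {k} := by
      ext i; simp only [Set.mem_Iio, Set.mem_union, Set.mem_singleton_iff]; omega
    rw [this, Set.image_union, Set.image_singleton]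

lemma gp_disjoint {d : ℕ} {F₁ F₂ F₃ : CompleteFlag d} (hF : GenPos ![F₁, F₂, F₃]) {a b : ℕ}
    (h : a + b = d) {x : Fin d → ℂ} (h1 : x ∈ F₁.space a) (h2 : x ∈ F₂.space b) : x = 0 := by
  have e := gp_sup hF (a := a) (b := b) (c := 0) (by omega)
  rw [Submodule.finrank_eq_zero.mp (F₃.finrank_eq 0 (Nat.zero_le _)), sup_bot_eq] at e
  have e1 := Submodule.finrank_sup_add_finrank_inf_eq (F₁.space a) (F₂.space b)
  rw [e, F₁.finrank_eq a (by omega), F₂.finrank_eq b (by omega)] at e1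
  simp only [finrank_top, Module.finrank_fin_fun] at e1
  have e4 : F₁.space a ⊓ F₂.space b = ⊥ := Submodule.finrank_eq_zero.mp (by omega)
  have : x ∈ F₁.space a ⊓ F₂.space b := ⟨h1, h2⟩
  rwa [e4, Submodule.mem_bot] at this

/-- An adapted frame for the first two flags and the line of the third one. -/
lemma exists_frame {d : ℕ} (hd : 0 < d) {F₁ F₂ F₃ : CompleteFlag d} (hF : GenPos ![F₁, F₂, F₃]) :
    ∃ (e : ℕ → Fin d → ℂ) (B : Module.Basis (Fin d) ℂ (Fin d → ℂ)),
      (∀ i : Fin d, B i = e i) ∧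
      (∀ k ≤ d, F₁.space k = Submodule.span ℂ (e '' Set.Iio k)) ∧
      (∀ k ≤ d, F₂.space k = Submodule.span ℂ ((fun i => e (d - 1 - i)) '' Set.Iio k)) ∧
      F₃.space 1 = Submodule.span ℂ {∑ i : Fin d, B i} := by
  have hex : ∀ k, ∃ x : Fin d → ℂ, k < d → x ∈ F₁.space (k + 1) ∧ x ∈ F₂.space (d - k) ∧ x ≠ 0 := by
    intro k
    by_cases hk : k < d
    · have e1 := Submodule.finrank_sup_add_finrank_inf_eq (F₁.space (k + 1)) (F₂.space (d - k))
      rw [F₁.finrank_eq (k + 1) (by omega), F₂.finrank_eq (d - k) (by omega)] at e1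
      have e2 := Submodule.finrank_le (F₁.space (k + 1) ⊔ F₂.space (d - k))
      simp only [Module.finrank_fin_fun] at e2
      have e3 : F₁.space (k + 1) ⊓ F₂.space (d - k) ≠ ⊥ := by
        intro h0
        rw [h0, finrank_bot] at e1
        omega
      obtain ⟨x, hx, h0⟩ := Submodule.exists_mem_ne_zero_of_ne_bot e3
      exact ⟨x, fun _ => ⟨hx.1, hx.2, h0⟩⟩
    · exact ⟨0, fun h => absurd h hk⟩
  choose b hb using hex
  -- any rescaling is adapted
  have ad1 : ∀ e : ℕ → Fin d → ℂ,
      (∀ k < d, e k ∈ F₁.space (k + 1) ∧ e k ∈ F₂.space (d - k) ∧ e k ≠ 0) →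
      ∀ k ≤ d, F₁.space k = Submodule.span ℂ (e '' Set.Iio k) := by
    intro e he
    refine adapted F₁ fun k hk => ⟨(he k hk).1, fun hn => ?_⟩
    exact (he k hk).2.2 (gp_disjoint hF (by omega) hn (he k hk).2.1)
  have ad2 : ∀ e : ℕ → Fin d → ℂ,
      (∀ k < d, e k ∈ F₁.space (k + 1) ∧ e k ∈ F₂.space (d - k) ∧ e k ≠ 0) →
      ∀ k ≤ d, F₂.space k = Submodule.span ℂ ((fun i => e (d - 1 - i)) '' Set.Iio k) := by
    intro e he
    refine adapted F₂ fun k hk => ?_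
    obtain ⟨q1, q2, q3⟩ := he (d - 1 - k) (by omega)
    have s : d - (d - 1 - k) = k + 1 := by omega
    rw [s] at q2
    exact ⟨q2, fun hn => q3 (gp_disjoint hF (by omega) q1 hn)⟩
  have bas : ∀ e : ℕ → Fin d → ℂ,
      (∀ k < d, e k ∈ F₁.space (k + 1) ∧ e k ∈ F₂.space (d - k) ∧ e k ≠ 0) →
      ∃ B : Module.Basis (Fin d) ℂ (Fin d → ℂ), ∀ i : Fin d, B i = e i := by
    intro e he
    have h1 := ad1 e he d le_rfl
    rw [F₁.eq_top d le_rfl] at h1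
    have h2 : e '' Set.Iio d = Set.range (fun i : Fin d => e i) := by
      ext v; constructor
      · rintro ⟨i, hi, rfl⟩; exact ⟨⟨i, hi⟩, rfl⟩
      · rintro ⟨i, rfl⟩; exact ⟨i, i.2, rfl⟩
    rw [h2] at h1
    exact ⟨basisOfTopLeSpanOfCardEqFinrank _ h1.le (by simp), fun i => by simp⟩
  obtain ⟨B, hB⟩ := bas b hb
  obtain ⟨p, hp, hp0⟩ := exists_new F₃ hd
  have hs := space_succ F₃ hd hp hp0
  rw [Submodule.finrank_eq_zero.mp (F₃.finrank_eq 0 (Nat.zero_le _)), bot_sup_eq] at hs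
  have hc : ∀ k : Fin d, B.repr p k ≠ 0 := by
    intro k hk
    have hpm : p ∈ F₁.space k ⊔ F₂.space (d - 1 - k) := by
      rw [← B.sum_repr p]
      refine Submodule.sum_mem _ fun i _ => ?_
      rcases lt_trichotomy (i : ℕ) k with h | h | h
      · refine Submodule.smul_mem _ _ (Submodule.mem_sup_left ?_)
        rw [hB]
        exact F₁.mono h (hb i i.2).1
      · rw [Fin.ext h, hk, zero_smul]; exact Submodule.zero_mem _
      · refine Submodule.smul_mem _ _ (Submodule.mem_sup_right ?_)
        rw [hB]
        exact F₂.mono (by omega) (hb i i.2).2.1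
    have hk2 := k.2
    have e := gp_sup hF (a := k) (b := d - 1 - k) (c := 1) (by omega)
    have hle : F₃.space 1 ≤ F₁.space k ⊔ F₂.space (d - 1 - k) := by
      rw [hs, Submodule.span_singleton_le_iff_mem]; exact hpm
    rw [sup_eq_left.mpr hle] at e
    have := finrank_sup_le (F₁.finrank_eq k (by omega)).le (F₂.finrank_eq (d - 1 - k) (by omega)).le
    rw [e] at this
    simp only [finrank_top, Module.finrank_fin_fun] at this
    omega
  let e : ℕ → Fin d → ℂ := fun k => if h : k < d then B.repr p ⟨k, h⟩ • b k else 0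
  have he : ∀ k < d, e k ∈ F₁.space (k + 1) ∧ e k ∈ F₂.space (d - k) ∧ e k ≠ 0 := by
    intro k hk
    obtain ⟨q1, q2, q3⟩ := hb k hk
    simp only [e, dif_pos hk]
    exact ⟨Submodule.smul_mem _ _ q1, Submodule.smul_mem _ _ q2, smul_ne_zero (hc _) q3⟩
  obtain ⟨B', hB'⟩ := bas e he
  refine ⟨e, B', hB', ad1 e he, ad2 e he, ?_⟩
  rw [hs]
  congr 2
  conv_lhs => rw [← B.sum_repr p]
  refine Finset.sum_congr rfl fun i _ => ?_
  rw [hB', hB]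
  simp [e]

/-- The image of a flag under a linear automorphism. -/
noncomputable def mapFlag {d : ℕ} (A : (Fin d → ℂ) ≃ₗ[ℂ] (Fin d → ℂ)) (F : CompleteFlag d) :
    CompleteFlag d where
  space k := (F.space k).map (A : (Fin d → ℂ) →ₗ[ℂ] (Fin d → ℂ))
  mono := fun _ _ h => Submodule.map_mono (F.mono h)
  finrank_eq k hk := by rw [LinearEquiv.finrank_map_eq, F.finrank_eq k hk]
  eq_top k hk := by rw [F.eq_top k hk]; simp

lemma gp_map {d : ℕ} (A : (Fin d → ℂ) ≃ₗ[ℂ] (Fin d → ℂ)) {F₁ F₂ F₃ : CompleteFlag d}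
    (hF : GenPos ![F₁, F₂, F₃]) : GenPos ![mapFlag A F₁, mapFlag A F₂, mapFlag A F₃] := by
  intro k hk
  have h := congrArg (Submodule.map (A : (Fin d → ℂ) →ₗ[ℂ] (Fin d → ℂ))) (hF k hk)
  rw [Submodule.map_iSup] at h
  have ht : Submodule.map (A : (Fin d → ℂ) →ₗ[ℂ] (Fin d → ℂ)) ⊤ = ⊤ := by simp
  rw [ht] at h
  rw [← h]
  congr 1
  funext i
  fin_cases i <;> rfl

lemma exists_normalize {d : ℕ} (hd : 0 < d) {F₁ F₂ F₃ G₁ G₂ G₃ : CompleteFlag d}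
    (hF : GenPos ![F₁, F₂, F₃]) (hG : GenPos ![G₁, G₂, G₃]) :
    ∃ A : (Fin d → ℂ) ≃ₗ[ℂ] (Fin d → ℂ), (∀ k, (mapFlag A F₁).space k = G₁.space k) ∧
      (∀ k, (mapFlag A F₂).space k = G₂.space k) ∧ (mapFlag A F₃).space 1 = G₃.space 1 := by
  obtain ⟨e, B, hB, h1, h2, h3⟩ := exists_frame hd hF
  obtain ⟨e', B', hB', h1', h2', h3'⟩ := exists_frame hd hG
  let A := B.equiv B' (Equiv.refl _)
  have hA : ∀ k < d, A (e k) = e' k := by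
    intro k hk
    have := hB ⟨k, hk⟩
    simp only at this
    rw [← this, B.equiv_apply, hB']; rfl
  refine ⟨A, ?_, ?_, ?_⟩
  · intro k
    by_cases hk : k ≤ d
    · change Submodule.map _ _ = _
      rw [h1 k hk, h1' k hk, Submodule.map_span, Set.image_image]
      congr 1
      refine Set.image_congr fun i hi => hA i (lt_of_lt_of_le hi hk)
    · rw [CompleteFlag.eq_top _ k (by omega), CompleteFlag.eq_top _ k (by omega)]
  · intro k
    by_cases hk : k ≤ d
    · change Submodule.map _ _ = _
      rw [h2 k hk, h2' k hk, Submodule.map_span, Set.image_image]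
      congr 1
      refine Set.image_congr fun i hi => hA _ (by omega)
    · rw [CompleteFlag.eq_top _ k (by omega), CompleteFlag.eq_top _ k (by omega)]
  · change Submodule.map _ _ = _
    rw [h3, h3', Submodule.map_span, Set.image_singleton]
    congr 2
    simp [A]

end TripleProof

/-- Proposition 2.1(1): two triples of complete flags in general position are
projectively equivalent iff they have the same triple ratios `T^j` for all `j ∈ ℬ`. -/
theorem triples_projectively_equivalent_iff_tripleRatios_eq
    (d : ℕ) (hd : 2 ≤ d) (φ : ExtAlg d →ₗ[ℂ] ℂ) (hφ : IsTopIso φ)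
    (F₁ F₂ F₃ G₁ G₂ G₃ : CompleteFlag d)
    (hF : GenPos ![F₁, F₂, F₃]) (hG : GenPos ![G₁, G₂, G₃]) :
    (∃ A : (Fin d → ℂ) ≃ₗ[ℂ] (Fin d → ℂ),
        (∀ k, Submodule.map (A : (Fin d → ℂ) →ₗ[ℂ] (Fin d → ℂ)) (F₁.space k) = G₁.space k) ∧
        (∀ k, Submodule.map (A : (Fin d → ℂ) →ₗ[ℂ] (Fin d → ℂ)) (F₂.space k) = G₂.space k) ∧
        (∀ k, Submodule.map (A : (Fin d → ℂ) →ₗ[ℂ] (Fin d → ℂ)) (F₃.space k) = G₃.space k)) ↔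
      (∀ j ∈ Bset d, tripleRatio φ F₁ F₂ F₃ j = tripleRatio φ G₁ G₂ G₃ j) := by
  constructor
  · rintro ⟨A, h1, h2, h3⟩ j hj
    exact TripleProof.ratio_invariant hφ hF A h1 h2 h3 hj
  · intro hT
    obtain ⟨A, h1, h2, h3⟩ := TripleProof.exists_normalize (by omega : 0 < d) hF hG
    refine ⟨A, h1, h2, ?_⟩
    refine TripleProof.all_eq hφ (TripleProof.gp_map A hF) hG h1 h2 ?_ h3
    intro j hj
    rw [← hT j hj]
    exact (TripleProof.ratio_invariant hφ hF A (fun _ => rfl) (fun _ => rfl) (fun _ => rfl) hj).symm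
end

section
/- Let d ≥ 2 be an integer and let (F₁,F₂,G₁,G₂) and (H₁,H₂,K₁,K₂) be quadruples of complete flags in ℂ^d such that (F₁,F₂,G_k) and (H₁,H₂,K_k) are in general position for k=1,2. Then the two quadruples are projectively equivalent if and only if T^j(F₁,F₂,G₁)=T^j(H₁,H₂,K₁) and T^j(F₁,F₂,G₂)=T^j(H₁,H₂,K₂) for all j∈ℬ, and D^i(F₁,F₂,G₁,G₂)=D^i(H₁,H₂,K₁,K₂) for all i∈𝒜. -/
open scoped BigOperators

open ExteriorAlgebra in
lemma qf_map_pow_range {d : ℕ} (S : Submodule ℂ (Fin d → ℂ)) (k : ℕ) :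
    (Submodule.map (ι ℂ) S : Submodule ℂ (ExtAlg d)) ^ k
      = Submodule.map (ExteriorAlgebra.map S.subtype).toLinearMap (⋀[ℂ]^k S) := by
  have h : (Submodule.map (ι ℂ) S : Submodule ℂ (ExtAlg d))
      = Submodule.map (ExteriorAlgebra.map S.subtype).toLinearMap
          (LinearMap.range (ι ℂ : S →ₗ[ℂ] _)) := by
    rw [LinearMap.range_eq_map, ← Submodule.map_comp, ExteriorAlgebra.map_comp_ι,
      Submodule.map_comp]
    simp
  rw [h]
  exact (Submodule.map_pow _ (ExteriorAlgebra.map S.subtype) k).symm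

lemma qf_finrank_pow {d : ℕ} (S : Submodule ℂ (Fin d → ℂ)) (k : ℕ)
    (hS : Module.finrank ℂ S = k) :
    Module.finrank ℂ ↥((Submodule.map (ExteriorAlgebra.ι ℂ) S : Submodule ℂ (ExtAlg d)) ^ k)
      = 1 := by
  have hinj : Function.Injective (ExteriorAlgebra.map S.subtype).toLinearMap :=
    ExteriorAlgebra.map_injective_field (by simp)
  rw [qf_map_pow_range, ← (Submodule.equivMapOfInjective _ hinj _).finrank_eq,
    exteriorPower.finrank_eq, hS, Nat.choose_self]

lemma qf_topPower {d : ℕ} : topPower d =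
    (Submodule.map (ExteriorAlgebra.ι ℂ) (⊤ : Submodule ℂ (Fin d → ℂ))) ^ d := by
  rw [topPower, LinearMap.range_eq_map]

lemma qf_finrank_topPower {d : ℕ} : Module.finrank ℂ (topPower d) = 1 := by
  rw [qf_topPower]
  exact qf_finrank_pow _ _ (by simp)

lemma qf_finrank_flagPower {d : ℕ} (F : CompleteFlag d) {k : ℕ} (hk : k ≤ d) :
    Module.finrank ℂ (flagPower F k) = 1 := qf_finrank_pow _ _ (F.finrank_eq k hk)

lemma qf_prop {E : Type*} [AddCommGroup E] [Module ℂ E] {W : Submodule ℂ E}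
    (hW : Module.finrank ℂ W = 1) {x y : E} (hx : x ∈ W) (hx0 : x ≠ 0) (hy : y ∈ W) :
    ∃ c : ℂ, y = c • x := by
  have := (finrank_eq_one_iff_of_nonzero' (⟨x, hx⟩ : W) (by simpa using hx0)).1 hW ⟨y, hy⟩
  obtain ⟨c, hc⟩ := this
  exact ⟨c, by simpa using (congrArg Subtype.val hc).symm⟩

lemma qf_prop' {E : Type*} [AddCommGroup E] [Module ℂ E] {W : Submodule ℂ E}
    (hW : Module.finrank ℂ W = 1) {x y : E} (hx : x ∈ W) (hx0 : x ≠ 0) (hy : y ∈ W)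
    (hy0 : y ≠ 0) : ∃ c : ℂ, c ≠ 0 ∧ y = c • x := by
  obtain ⟨c, hc⟩ := qf_prop hW hx hx0 hy
  refine ⟨c, ?_, hc⟩
  rintro rfl
  simp [hc] at hy0

lemma qf_ex_ne {E : Type*} [AddCommGroup E] [Module ℂ E] {W : Submodule ℂ E}
    (hW : Module.finrank ℂ W = 1) : ∃ x, x ∈ W ∧ x ≠ 0 := by
  have : W ≠ ⊥ := by rintro rfl; simp at hW
  exact Submodule.exists_mem_ne_zero_of_ne_bot this

lemma qf_flagElt {d : ℕ} (F : CompleteFlag d) {k : ℕ} (hk : k ≤ d) :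
    flagElt F k ∈ flagPower F k ∧ flagElt F k ≠ 0 := by
  have h := qf_ex_ne (qf_finrank_flagPower F hk)
  unfold flagElt
  rw [dif_pos h]
  exact h.choose_spec

lemma qf_flagElt_congr {d : ℕ} (F G : CompleteFlag d) {k : ℕ} (h : F.space k = G.space k) :
    flagElt F k = flagElt G k := by
  have : flagPower F k = flagPower G k := by rw [flagPower, flagPower, h]
  unfold flagElt
  rw [this]

/-- wedge of a list -/
noncomputable def qfW {d : ℕ} (l : List (Fin d → ℂ)) : ExtAlg d :=
  (l.map (ExteriorAlgebra.ι ℂ)).prod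

lemma qfW_append {d : ℕ} (l m : List (Fin d → ℂ)) : qfW (l ++ m) = qfW l * qfW m := by
  simp [qfW]

lemma qfW_mem {d : ℕ} (l : List (Fin d → ℂ)) (S : Submodule ℂ (Fin d → ℂ))
    (h : ∀ v ∈ l, v ∈ S) :
    qfW l ∈ (Submodule.map (ExteriorAlgebra.ι ℂ) S : Submodule ℂ (ExtAlg d)) ^ l.length := by
  induction l with
  | nil => simp [qfW]
  | cons a t ih =>
    rw [List.length_cons, pow_succ']
    have : qfW (a :: t) = ExteriorAlgebra.ι ℂ a * qfW t := by simp [qfW]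
    rw [this]
    exact Submodule.mul_mem_mul (Submodule.mem_map_of_mem (h a (by simp)))
      (ih fun v hv => h v (by simp [hv]))

lemma qfW_top {d : ℕ} (l : List (Fin d → ℂ)) (φ : ExtAlg d →ₗ[ℂ] ℂ) (hφ : IsTopIso φ)
    (hl : l.length = d) (hs : Submodule.span ℂ {v | v ∈ l} = ⊤) : φ (qfW l) ≠ 0 := by
  have hr : Set.range l.get = {v | v ∈ l} := by ext v; simp [List.mem_iff_get]
  let b := basisOfTopLeSpanOfCardEqFinrank (R := ℂ) l.get (by rw [hr, hs]) (by simp [hl])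
  have hb : ⇑b = l.get := coe_basisOfTopLeSpanOfCardEqFinrank _ _ _
  let f := φ.compAlternatingMap (ExteriorAlgebra.ιMulti ℂ l.length (M := Fin d → ℂ))
  have hf : φ (qfW l) = f b := by
    rw [hb]
    simp only [f, LinearMap.compAlternatingMap_apply, ExteriorAlgebra.ιMulti_apply]
    congr 1
    rw [qfW]
    congr 1
    conv_lhs => rw [← List.ofFn_get l]
    rw [List.map_ofFn]
    rfl
  rw [hf]
  intro h0
  have hz := (AlternatingMap.map_basis_eq_zero_iff b f).1 h0
  obtain ⟨x, hx, hx0⟩ := qf_ex_ne (qf_finrank_topPower (d := d))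
  apply hx0
  apply hφ x hx
  have : topPower d ≤ LinearMap.ker φ := by
    have := ExteriorAlgebra.ιMulti_span_fixedDegree ℂ (M := Fin d → ℂ) l.length
    have h2 : topPower d = (⋀[ℂ]^l.length (Fin d → ℂ)) := by rw [hl]; rfl
    rw [h2, ← this, Submodule.span_le]
    rintro _ ⟨v, rfl⟩
    exact congrArg (fun g => g v) hz
  exact this hx

lemma qf_list {d : ℕ} (S : Submodule ℂ (Fin d → ℂ)) :
    ∃ l : List (Fin d → ℂ), l.length = Module.finrank ℂ S ∧
      Submodule.span ℂ {v | v ∈ l} = S := by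
  let b := Module.finBasis ℂ S
  refine ⟨List.ofFn fun i => (b i : Fin d → ℂ), by simp, ?_⟩
  have : {v | v ∈ List.ofFn fun i => (b i : Fin d → ℂ)} = S.subtype '' Set.range b := by
    ext v; simp [List.mem_ofFn]
  rw [this, ← Submodule.map_span, b.span_eq]
  simp

lemma qf_span_append {d : ℕ} (l m : List (Fin d → ℂ)) :
    Submodule.span ℂ {v | v ∈ l ++ m} =
      Submodule.span ℂ {v | v ∈ l} ⊔ Submodule.span ℂ {v | v ∈ m} := by
  rw [← Submodule.span_union]
  congr 1
  ext v; simp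

lemma qfW_ne {d : ℕ} (φ : ExtAlg d →ₗ[ℂ] ℂ) (hφ : IsTopIso φ) (l : List (Fin d → ℂ))
    (h : l.length = Module.finrank ℂ (Submodule.span ℂ {v | v ∈ l})) : qfW l ≠ 0 := by
  obtain ⟨T, hT⟩ := Submodule.exists_isCompl (Submodule.span ℂ {v | v ∈ l})
  obtain ⟨m, hm, hms⟩ := qf_list T
  intro h0
  apply qfW_top (l ++ m) φ hφ
  · rw [List.length_append, h, hm, Submodule.finrank_add_eq_of_isCompl hT]
    simp
  · rw [qf_span_append, hms, hT.sup_eq_top]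
  · rw [qfW_append, h0]; simp

/-- description of flagElt by a list -/
lemma qf_flagElt_of_list {d : ℕ} (φ : ExtAlg d →ₗ[ℂ] ℂ) (hφ : IsTopIso φ) (F : CompleteFlag d)
    {k : ℕ} (hk : k ≤ d) (l : List (Fin d → ℂ)) (hl : l.length = k)
    (hs : Submodule.span ℂ {v | v ∈ l} = F.space k) :
    ∃ c : ℂ, c ≠ 0 ∧ flagElt F k = c • qfW l := by
  have h1 : qfW l ∈ flagPower F k := by
    have := qfW_mem l (F.space k) (by rw [← hs]; exact fun v hv => Submodule.subset_span hv)
    rwa [hl] at this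
  have h2 : qfW l ≠ 0 := qfW_ne φ hφ l (by rw [hs, F.finrank_eq k hk, hl])
  exact qf_prop' (qf_finrank_flagPower F hk) h1 h2 (qf_flagElt F hk).1 (qf_flagElt F hk).2

lemma qf_flag_list {d : ℕ} (φ : ExtAlg d →ₗ[ℂ] ℂ) (hφ : IsTopIso φ) (F : CompleteFlag d)
    {k : ℕ} (hk : k ≤ d) : ∃ (l : List (Fin d → ℂ)) (c : ℂ), l.length = k ∧
    Submodule.span ℂ {v | v ∈ l} = F.space k ∧ c ≠ 0 ∧ flagElt F k = c • qfW l := by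
  obtain ⟨l, hl, hs⟩ := qf_list (F.space k)
  rw [F.finrank_eq k hk] at hl
  obtain ⟨c, hc, h⟩ := qf_flagElt_of_list φ hφ F hk l hl hs
  exact ⟨l, c, hl, hs, hc, h⟩

lemma qf_sup {d : ℕ} {F₁ F₂ G : CompleteFlag d} (h : GenPos ![F₁, F₂, G]) {a b c : ℕ}
    (habc : a + b + c = d) : F₁.space a ⊔ F₂.space b ⊔ G.space c = ⊤ := by
  have := h ![a, b, c] (by simpa [Fin.sum_univ_three] using habc)
  rw [eq_top_iff, ← this]
  refine iSup_le fun i => ?_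
  fin_cases i
  · exact le_sup_of_le_left le_sup_left
  · exact le_sup_of_le_left le_sup_right
  · exact le_sup_right

lemma qf_nonzero {d : ℕ} (φ : ExtAlg d →ₗ[ℂ] ℂ) (hφ : IsTopIso φ) {F₁ F₂ G : CompleteFlag d}
    (h : GenPos ![F₁, F₂, G]) {a b c : ℕ} (habc : a + b + c = d) :
    φ (flagElt F₁ a * flagElt F₂ b * flagElt G c) ≠ 0 := by
  obtain ⟨l, r, hl, hs, hr, e⟩ := qf_flag_list φ hφ F₁ (k := a) (by omega)
  obtain ⟨l', r', hl', hs', hr', e'⟩ := qf_flag_list φ hφ F₂ (k := b) (by omega)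
  obtain ⟨l'', r'', hl'', hs'', hr'', e''⟩ := qf_flag_list φ hφ G (k := c) (by omega)
  have key := qfW_top (l ++ l' ++ l'') φ hφ (by simp [hl, hl', hl'']; omega)
    (by rw [qf_span_append, qf_span_append, hs, hs', hs'', qf_sup h habc])
  rw [qfW_append, qfW_append] at key
  rw [e, e', e'']
  simp [hr, hr', hr'', key]

lemma qf_comm {d : ℕ} {x : ExtAlg d} {k : ℕ}
    (hx : x ∈ (LinearMap.range (ExteriorAlgebra.ι ℂ : (Fin d → ℂ) →ₗ[ℂ] ExtAlg d)) ^ k)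
    (v : Fin d → ℂ) :
    x * ExteriorAlgebra.ι ℂ v = (-1 : ℂ) ^ k • (ExteriorAlgebra.ι ℂ v * x) := by
  induction hx using Submodule.pow_induction_on_left' with
  | algebraMap r => rw [Algebra.commutes]; simp
  | add x y i hx hy h1 h2 => rw [add_mul, mul_add, h1, h2, smul_add]
  | mem_mul m hm i x hx ih =>
    obtain ⟨w, rfl⟩ := hm
    have := ExteriorAlgebra.ι_add_mul_swap (R := ℂ) w v
    rw [mul_assoc, ih, mul_smul_comm, ← mul_assoc, eq_neg_of_add_eq_zero_left this, pow_succ,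
      mul_smul, neg_one_smul, neg_mul, mul_assoc]

lemma qfW_mem_range {d : ℕ} (l : List (Fin d → ℂ)) : qfW l ∈
    (LinearMap.range (ExteriorAlgebra.ι ℂ : (Fin d → ℂ) →ₗ[ℂ] ExtAlg d)) ^ l.length := by
  rw [LinearMap.range_eq_map]
  exact qfW_mem l ⊤ (by simp)

lemma qfW_mul_mem {d : ℕ} (l : List (Fin d → ℂ)) {y : Fin d → ℂ} (hy : y ∈ l) :
    qfW l * ExteriorAlgebra.ι ℂ y = 0 := by
  induction l with
  | nil => simp at hy
  | cons a t ih =>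
    have e : qfW (a :: t) = ExteriorAlgebra.ι ℂ a * qfW t := by simp [qfW]
    rw [e, mul_assoc]
    rcases List.mem_cons.1 hy with rfl | h
    · rw [qf_comm (qfW_mem_range t), mul_smul_comm, ← mul_assoc, ExteriorAlgebra.ι_sq_zero]
      simp
    · rw [ih h, mul_zero]

lemma qf_flagElt_mul_ι {d : ℕ} (φ : ExtAlg d →ₗ[ℂ] ℂ) (hφ : IsTopIso φ) (F : CompleteFlag d)
    {k : ℕ} (hk : k ≤ d) {y : Fin d → ℂ} (hy : y ∈ F.space k) :
    flagElt F k * ExteriorAlgebra.ι ℂ y = 0 := by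
  obtain ⟨l, r, hl, hs, hr, e⟩ := qf_flag_list φ hφ F hk
  rw [← hs] at hy
  induction hy using Submodule.span_induction with
  | mem x h => rw [e, smul_mul_assoc, qfW_mul_mem l h, smul_zero]
  | zero => simp
  | add x y _ _ h1 h2 => rw [map_add, mul_add, h1, h2, add_zero]
  | smul c x _ h => rw [map_smul, mul_smul_comm, h, smul_zero]

lemma qf_space_succ {d : ℕ} (F : CompleteFlag d) {k : ℕ} (hk : k < d) {v : Fin d → ℂ}
    (hv : v ∈ F.space (k + 1)) (hv' : v ∉ F.space k) :
    F.space (k + 1) = F.space k ⊔ Submodule.span ℂ {v} := by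
  symm
  have hle : F.space k ⊔ Submodule.span ℂ {v} ≤ F.space (k + 1) := by
    refine sup_le (F.mono (by omega)) ?_
    rwa [Submodule.span_singleton_le_iff_mem]
  apply Submodule.eq_of_le_of_finrank_le hle
  rw [F.finrank_eq (k + 1) (by omega)]
  have hlt : F.space k < F.space k ⊔ Submodule.span ℂ {v} := by
    refine lt_of_le_of_ne le_sup_left fun h => hv' ?_
    rw [h]
    exact (le_sup_right : _ ≤ F.space k ⊔ Submodule.span ℂ {v}) (Submodule.mem_span_singleton_self v)
  have := Submodule.finrank_lt_finrank_of_lt hlt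
  rw [F.finrank_eq k (by omega)] at this
  omega

lemma qf_succ {d : ℕ} (φ : ExtAlg d →ₗ[ℂ] ℂ) (hφ : IsTopIso φ) (F : CompleteFlag d)
    {k : ℕ} (hk : k < d) : ∃ v, F.space (k + 1) = F.space k ⊔ Submodule.span ℂ {v} ∧
      flagElt F (k + 1) = flagElt F k * ExteriorAlgebra.ι ℂ v := by
  have hlt : F.space k < F.space (k + 1) := by
    refine lt_of_le_of_ne (F.mono (by omega)) fun h => ?_
    have h1 := F.finrank_eq k (by omega)
    have h2 := F.finrank_eq (k + 1) (by omega)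
    rw [h, h2] at h1
    omega
  obtain ⟨v, hv, hv'⟩ := SetLike.exists_of_lt hlt
  have hsucc := qf_space_succ F hk hv hv'
  obtain ⟨l, r, hl, hs, hr, e⟩ := qf_flag_list φ hφ F (k := k) (by omega)
  obtain ⟨c, hc, e'⟩ := qf_flagElt_of_list φ hφ F (k := k + 1) (by omega) (l ++ [v]) (by simp [hl])
    (by rw [qf_span_append, hs, hsucc]; simp)
  refine ⟨(c / r) • v, ?_, ?_⟩
  · rw [hsucc, Submodule.span_singleton_smul_eq (IsUnit.mk0 _ (div_ne_zero hc hr))]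
  · rw [e', e, qfW_append, map_smul, smul_mul_smul_comm, mul_div_cancel₀ _ hr]
    simp [qfW]

lemma qf_mem_range_flag {d : ℕ} (F : CompleteFlag d) {k : ℕ} (hk : k ≤ d) :
    flagElt F k ∈ (LinearMap.range (ExteriorAlgebra.ι ℂ : (Fin d → ℂ) →ₗ[ℂ] ExtAlg d)) ^ k := by
  have h : Submodule.map (ExteriorAlgebra.ι ℂ) (F.space k) ≤
      LinearMap.range (ExteriorAlgebra.ι ℂ : (Fin d → ℂ) →ₗ[ℂ] ExtAlg d) := by
    rw [LinearMap.range_eq_map]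
    exact Submodule.map_mono le_top
  have h2 := pow_le_pow_left' h k
  exact h2 (qf_flagElt F hk).1

/-- the functional `v ↦ φ (f₁^a ∧ f₂^b ∧ g^k ∧ v)` -/
noncomputable def qfL {d : ℕ} (φ : ExtAlg d →ₗ[ℂ] ℂ) (F₁ F₂ G : CompleteFlag d) (a b k : ℕ) :
    (Fin d → ℂ) →ₗ[ℂ] ℂ :=
  φ ∘ₗ (LinearMap.mulLeft ℂ (flagElt F₁ a * flagElt F₂ b * flagElt G k)) ∘ₗ ExteriorAlgebra.ι ℂ

lemma qfL_apply {d : ℕ} (φ : ExtAlg d →ₗ[ℂ] ℂ) (F₁ F₂ G : CompleteFlag d) (a b k : ℕ)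
    (v : Fin d → ℂ) : qfL φ F₁ F₂ G a b k v =
      φ (flagElt F₁ a * flagElt F₂ b * (flagElt G k * ExteriorAlgebra.ι ℂ v)) := by
  simp [qfL, mul_assoc]

lemma qfL_apply' {d : ℕ} (φ : ExtAlg d →ₗ[ℂ] ℂ) (F₁ F₂ G : CompleteFlag d) {a b k : ℕ}
    (h : a + b + k ≤ d)
    (v : Fin d → ℂ) : qfL φ F₁ F₂ G a b k v = (-1) ^ (b + k) *
      φ (flagElt F₁ a * ExteriorAlgebra.ι ℂ v * flagElt F₂ b * flagElt G k) := by
  have hm : flagElt F₂ b * flagElt G k ∈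
      (LinearMap.range (ExteriorAlgebra.ι ℂ : (Fin d → ℂ) →ₗ[ℂ] ExtAlg d)) ^ (b + k) := by
    rw [pow_add]
    exact Submodule.mul_mem_mul (qf_mem_range_flag _ (by omega)) (qf_mem_range_flag _ (by omega))
  rw [qfL_apply, mul_assoc, ← mul_assoc (flagElt F₂ b), qf_comm hm, mul_smul_comm, map_smul,
    smul_eq_mul]
  simp only [mul_assoc]

lemma qf_inter {d : ℕ} (φ : ExtAlg d →ₗ[ℂ] ℂ) (hφ : IsTopIso φ) {F₁ F₂ G : CompleteFlag d}
    (h : GenPos ![F₁, F₂, G]) {k n : ℕ} (hn : n + k = d) (x : Fin d → ℂ)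
    (hx : ∀ a b, a + b + 1 = n → qfL φ F₁ F₂ G a b k x = 0) : x ∈ G.space k := by
  have key : ∀ m, m ≤ n → x ∈ F₁.space m ⊔ G.space k → x ∈ G.space k := by
    intro m
    induction m with
    | zero =>
      intro _ hx0
      have : F₁.space 0 = ⊥ := by
        rw [← Submodule.finrank_eq_zero (R := ℂ)]; exact F₁.finrank_eq 0 (by omega)
      simpa [this] using hx0
    | succ m ih =>
      intro hm hxm
      apply ih (by omega)
      obtain ⟨u, hu, hu'⟩ := qf_succ φ hφ F₁ (k := m) (by omega)
      rw [hu, Submodule.mem_sup] at hxm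
      obtain ⟨y, hy, z, hz, rfl⟩ := hxm
      rw [Submodule.mem_sup] at hy
      obtain ⟨w, hw, t, ht, rfl⟩ := hy
      obtain ⟨c, rfl⟩ := Submodule.mem_span_singleton.1 ht
      have h0 := hx m (n - 1 - m) (by omega)
      have e1 : qfL φ F₁ F₂ G m (n - 1 - m) k w = 0 := by
        rw [qfL_apply' _ _ _ _ (by omega), qf_flagElt_mul_ι φ hφ F₁ (by omega) hw]; simp
      have e2 : qfL φ F₁ F₂ G m (n - 1 - m) k z = 0 := by
        rw [qfL_apply, qf_flagElt_mul_ι φ hφ G (by omega) hz]; simp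
      have e3 : qfL φ F₁ F₂ G m (n - 1 - m) k u ≠ 0 := by
        rw [qfL_apply' _ _ _ _ (by omega), ← hu']
        exact mul_ne_zero (pow_ne_zero _ (by norm_num)) (qf_nonzero φ hφ h (by omega))
      rw [map_add, map_add, map_smul, e1, e2, zero_add, add_zero, smul_eq_mul] at h0
      have hc : c = 0 := by simpa [e3] using h0
      rw [hc, zero_smul, add_zero]
      exact Submodule.add_mem_sup hw hz
  apply key n le_rfl
  have h1 := qf_sup h (a := n) (b := 0) (c := k) (by omega)
  have : F₂.space 0 = ⊥ := by
    rw [← Submodule.finrank_eq_zero (R := ℂ)]; exact F₂.finrank_eq 0 (by omega)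
  rw [this, sup_bot_eq] at h1
  rw [h1]; trivial

lemma qf_step {d : ℕ} (φ : ExtAlg d →ₗ[ℂ] ℂ) (hφ : IsTopIso φ) {F₁ F₂ G G' : CompleteFlag d}
    (h : GenPos ![F₁, F₂, G]) {k : ℕ} (hk : k < d)
    (hG : G.space k = G'.space k)
    (hr : ∀ a b, a + b + 2 + k = d →
      φ (flagElt F₁ (a + 1) * flagElt F₂ b * flagElt G (k + 1)) *
        φ (flagElt F₁ a * flagElt F₂ (b + 1) * flagElt G' (k + 1)) =
      φ (flagElt F₁ (a + 1) * flagElt F₂ b * flagElt G' (k + 1)) *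
        φ (flagElt F₁ a * flagElt F₂ (b + 1) * flagElt G (k + 1))) :
    G.space (k + 1) = G'.space (k + 1) := by
  obtain ⟨v, hv, ev⟩ := qf_succ φ hφ G hk
  obtain ⟨v', hv', ev'⟩ := qf_succ φ hφ G' hk
  rw [← qf_flagElt_congr G G' hG] at ev'
  rw [ev, ev'] at hr
  simp only [← qfL_apply] at hr
  have hnz : ∀ a b, a + b + 1 + k = d → qfL φ F₁ F₂ G a b k v ≠ 0 := by
    intro a b hab
    rw [qfL_apply, ← ev]
    exact qf_nonzero φ hφ h (by omega)
  set c : ℂ := qfL φ F₁ F₂ G 0 (d - k - 1) k v' / qfL φ F₁ F₂ G 0 (d - k - 1) k v with hc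
  have hall : ∀ a b, a + b + 1 + k = d →
      qfL φ F₁ F₂ G a b k v' = c * qfL φ F₁ F₂ G a b k v := by
    intro a
    induction a with
    | zero =>
      intro b hb
      have : b = d - k - 1 := by omega
      subst this
      rw [hc, div_mul_cancel₀ _ (hnz _ _ hb)]
    | succ a ih =>
      intro b hb
      have h1 := ih (b + 1) (by omega)
      have h2 := hr a b (by omega)
      rw [h1] at h2
      have h3 := hnz a (b + 1) (by omega)
      apply mul_right_cancel₀ h3
      rw [← h2]; ring
  have hx : v' - c • v ∈ G.space k := by
    apply qf_inter φ hφ h (n := d - k) (by omega)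
    intro a b hab
    rw [map_sub, map_smul, hall a b (by omega), smul_eq_mul, sub_self]
  symm
  apply Submodule.eq_of_le_of_finrank_le
  · rw [hv', hv, ← hG]
    refine sup_le le_sup_left ?_
    rw [Submodule.span_singleton_le_iff_mem]
    have : v' = (v' - c • v) + c • v := by abel
    rw [this]
    exact Submodule.add_mem_sup hx (Submodule.smul_mem _ _ (Submodule.mem_span_singleton_self v))
  · rw [G.finrank_eq _ (by omega), G'.finrank_eq _ (by omega)]

lemma qf_ext {d : ℕ} {F G : CompleteFlag d} (h : ∀ k, F.space k = G.space k) : F = G := by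
  cases F; cases G
  congr
  exact funext h

lemma qf_space_zero {d : ℕ} (F : CompleteFlag d) : F.space 0 = ⊥ := by
  rw [← Submodule.finrank_eq_zero (R := ℂ)]; exact F.finrank_eq 0 (by omega)

/-- triple ratios plus first line determine the flag -/
lemma qf_triple {d : ℕ} (φ : ExtAlg d →ₗ[ℂ] ℂ) (hφ : IsTopIso φ)
    {F₁ F₂ G G' : CompleteFlag d}
    (h : GenPos ![F₁, F₂, G]) (h' : GenPos ![F₁, F₂, G'])
    (h1 : G.space 1 = G'.space 1)
    (hT : ∀ j ∈ Bset d, tripleRatio φ F₁ F₂ G j = tripleRatio φ F₁ F₂ G' j) : G = G' := by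
  have key : ∀ k, G.space k = G'.space k ∧ G.space (k + 1) = G'.space (k + 1) := by
    intro k
    induction k with
    | zero => exact ⟨by rw [qf_space_zero, qf_space_zero], h1⟩
    | succ k ih =>
      refine ⟨ih.2, ?_⟩
      by_cases hk : k + 1 < d
      swap
      · rw [G.eq_top _ (by omega), G'.eq_top _ (by omega)]
      apply qf_step φ hφ h hk ih.2
      intro a b hab
      have hj := hT (a + 1, b + 1, k + 1) (by simp [Bset]; omega)
      simp only [tripleRatio, tripleRatioOf, Nat.add_sub_cancel] at hj
      rw [← qf_flagElt_congr G G' ih.1, ← qf_flagElt_congr G G' ih.2] at hj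
      have n1 := qf_nonzero φ hφ h (a := a + 1 + 1) (b := b + 1) (c := k) (by omega)
      have n2 := qf_nonzero φ hφ h (a := a + 1) (b := b) (c := k + 1 + 1) (by omega)
      have n3 := qf_nonzero φ hφ h (a := a) (b := b + 1 + 1) (c := k + 1) (by omega)
      have n4 := qf_nonzero φ hφ h (a := a) (b := b + 1) (c := k + 1 + 1) (by omega)
      have n5 := qf_nonzero φ hφ h (a := a + 1) (b := b + 1 + 1) (c := k) (by omega)
      have n6 := qf_nonzero φ hφ h (a := a + 1 + 1) (b := b) (c := k + 1) (by omega)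
      have n2' := qf_nonzero φ hφ h' (a := a + 1) (b := b) (c := k + 1 + 1) (by omega)
      have n4' := qf_nonzero φ hφ h' (a := a) (b := b + 1) (c := k + 1 + 1) (by omega)
      generalize φ (flagElt F₁ (a + 1 + 1) * flagElt F₂ (b + 1) * flagElt G k) = x1 at *
      generalize φ (flagElt F₁ (a + 1) * flagElt F₂ b * flagElt G (k + 1 + 1)) = x2 at *
      generalize φ (flagElt F₁ a * flagElt F₂ (b + 1 + 1) * flagElt G (k + 1)) = x3 at *
      generalize φ (flagElt F₁ a * flagElt F₂ (b + 1) * flagElt G (k + 1 + 1)) = x4 at *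
      generalize φ (flagElt F₁ (a + 1) * flagElt F₂ (b + 1 + 1) * flagElt G k) = x5 at *
      generalize φ (flagElt F₁ (a + 1 + 1) * flagElt F₂ b * flagElt G (k + 1)) = x6 at *
      rw [div_eq_div_iff (by simp [*]) (by simp [*])] at hj
      have hne : x1 * x3 * x5 * x6 ≠ 0 := by simp [*]
      apply mul_left_cancel₀ hne
      linear_combination hj
  exact qf_ext fun k => (key k).1

lemma qf_double {d : ℕ} (hd : 2 ≤ d) (φ : ExtAlg d →ₗ[ℂ] ℂ) (hφ : IsTopIso φ)
    {F₁ F₂ G K G' K' : CompleteFlag d}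
    (h : GenPos ![F₁, F₂, G]) 
    (hK : GenPos ![F₁, F₂, K]) (hK' : GenPos ![F₁, F₂, K'])
    (h1 : G.space 1 = G'.space 1)
    (hD : ∀ i ∈ Aset d, doubleRatio φ F₁ F₂ G K i = doubleRatio φ F₁ F₂ G' K' i) :
    K.space 1 = K'.space 1 := by
  apply qf_step φ hφ hK (k := 0) (by omega) (by rw [qf_space_zero, qf_space_zero])
  intro a b hab
  have hj := hD (a + 1, b + 1) (by simp [Aset]; omega)
  simp only [doubleRatio, doubleRatioOf, Nat.add_sub_cancel] at hj
  rw [← qf_flagElt_congr G G' h1, neg_inj] at hj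
  have n1 := qf_nonzero φ hφ h (a := a + 1) (b := b) (c := 1) (by omega)
  have n2 := qf_nonzero φ hφ h (a := a) (b := b + 1) (c := 1) (by omega)
  have n3 := qf_nonzero φ hφ hK (a := a + 1) (b := b) (c := 1) (by omega)
  have n4 := qf_nonzero φ hφ hK (a := a) (b := b + 1) (c := 1) (by omega)
  have n5 := qf_nonzero φ hφ hK' (a := a + 1) (b := b) (c := 1) (by omega)
  have n6 := qf_nonzero φ hφ hK' (a := a) (b := b + 1) (c := 1) (by omega)
  rw [div_eq_div_iff (mul_ne_zero n3 n2) (mul_ne_zero n5 n2)] at hj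
  apply mul_left_cancel₀ (mul_ne_zero n1 n2)
  rw [zero_add]
  linear_combination -hj

/-- image flag -/
noncomputable def qfMap {d : ℕ} (A : (Fin d → ℂ) ≃ₗ[ℂ] (Fin d → ℂ)) (F : CompleteFlag d) :
    CompleteFlag d where
  space k := Submodule.map (A : (Fin d → ℂ) →ₗ[ℂ] (Fin d → ℂ)) (F.space k)
  mono _ _ h := Submodule.map_mono (F.mono h)
  finrank_eq k hk := by
    rw [LinearEquiv.finrank_map_eq, F.finrank_eq k hk]
  eq_top k hk := by rw [F.eq_top k hk]; simp

lemma qfMap_elt {d : ℕ} (A : (Fin d → ℂ) ≃ₗ[ℂ] (Fin d → ℂ)) (F : CompleteFlag d) :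
    ∃ r : ℕ → ℂ, ∀ k, k ≤ d → r k ≠ 0 ∧ flagElt (qfMap A F) k =
      r k • ExteriorAlgebra.map (A : (Fin d → ℂ) →ₗ[ℂ] (Fin d → ℂ)) (flagElt F k) := by
  have : ∀ k, ∃ c : ℂ, k ≤ d → c ≠ 0 ∧ flagElt (qfMap A F) k =
      c • ExteriorAlgebra.map (A : (Fin d → ℂ) →ₗ[ℂ] (Fin d → ℂ)) (flagElt F k) := by
    intro k
    by_cases hk : k ≤ d
    swap
    · exact ⟨0, fun h => absurd h hk⟩
    have hinj : Function.Injective (ExteriorAlgebra.map (A : (Fin d → ℂ) →ₗ[ℂ] (Fin d → ℂ))) :=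
      ExteriorAlgebra.map_injective_field (by simp)
    have hmem : ExteriorAlgebra.map (A : (Fin d → ℂ) →ₗ[ℂ] (Fin d → ℂ)) (flagElt F k) ∈
        flagPower (qfMap A F) k := by
      have h1 : flagPower (qfMap A F) k = Submodule.map
          (ExteriorAlgebra.map (A : (Fin d → ℂ) →ₗ[ℂ] (Fin d → ℂ))).toLinearMap
          (flagPower F k) := by
        rw [flagPower, flagPower, Submodule.map_pow]
        congr 1
        rw [← Submodule.map_comp, ExteriorAlgebra.map_comp_ι, Submodule.map_comp]
        rfl
      rw [h1]
      exact Submodule.mem_map_of_mem (qf_flagElt F hk).1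
    obtain ⟨c, hc⟩ := qf_prop' (qf_finrank_flagPower (qfMap A F) hk) hmem
      ((map_ne_zero_iff _ hinj).2 (qf_flagElt F hk).2) (qf_flagElt _ hk).1 (qf_flagElt _ hk).2
    exact ⟨c, fun _ => hc⟩
  choose r hr using this
  exact ⟨r, hr⟩

lemma qfMap_det {d : ℕ} (φ : ExtAlg d →ₗ[ℂ] ℂ) (hφ : IsTopIso φ)
    (A : (Fin d → ℂ) ≃ₗ[ℂ] (Fin d → ℂ)) : ∃ δ : ℂ, δ ≠ 0 ∧ ∀ x ∈ topPower d,
      φ (ExteriorAlgebra.map (A : (Fin d → ℂ) →ₗ[ℂ] (Fin d → ℂ)) x) = δ * φ x := by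
  have hinj : Function.Injective (ExteriorAlgebra.map (A : (Fin d → ℂ) →ₗ[ℂ] (Fin d → ℂ))) :=
    ExteriorAlgebra.map_injective_field (by simp)
  obtain ⟨t, ht, ht0⟩ := qf_ex_ne (qf_finrank_topPower (d := d))
  have hmem : ExteriorAlgebra.map (A : (Fin d → ℂ) →ₗ[ℂ] (Fin d → ℂ)) t ∈ topPower d := by
    have h1 : topPower d = Submodule.map
        (ExteriorAlgebra.map (A : (Fin d → ℂ) →ₗ[ℂ] (Fin d → ℂ))).toLinearMap
        (topPower d) := by
      conv_lhs => rw [qf_topPower]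
      rw [qf_topPower, Submodule.map_pow]
      congr 1
      rw [← Submodule.map_comp, ExteriorAlgebra.map_comp_ι, Submodule.map_comp]
      simp
    rw [h1]
    exact Submodule.mem_map_of_mem ht
  obtain ⟨c, hc, e⟩ := qf_prop' (qf_finrank_topPower (d := d)) ht ht0 hmem
    ((map_ne_zero_iff _ hinj).2 ht0)
  refine ⟨c, hc, fun x hx => ?_⟩
  obtain ⟨s, rfl⟩ := qf_prop (qf_finrank_topPower (d := d)) ht ht0 hx
  rw [map_smul, e]
  simp only [map_smul, smul_eq_mul]
  ring

lemma qf_mem_top {d : ℕ} (F₁ F₂ G : CompleteFlag d) {a b c : ℕ} (h : a + b + c = d) :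
    flagElt F₁ a * flagElt F₂ b * flagElt G c ∈ topPower d := by
  subst h
  rw [topPower, pow_add, pow_add]
  exact Submodule.mul_mem_mul (Submodule.mul_mem_mul (qf_mem_range_flag _ (by omega))
    (qf_mem_range_flag _ (by omega))) (qf_mem_range_flag _ (by omega))

lemma qfMap_W {d : ℕ} (φ : ExtAlg d →ₗ[ℂ] ℂ)
    (A : (Fin d → ℂ) ≃ₗ[ℂ] (Fin d → ℂ)) {δ : ℂ} (hδ : ∀ x ∈ topPower d,
      φ (ExteriorAlgebra.map (A : (Fin d → ℂ) →ₗ[ℂ] (Fin d → ℂ)) x) = δ * φ x)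
    {F₁ F₂ G : CompleteFlag d} {r s t : ℕ → ℂ}
    (hr : ∀ k, k ≤ d → r k ≠ 0 ∧ flagElt (qfMap A F₁) k =
      r k • ExteriorAlgebra.map (A : (Fin d → ℂ) →ₗ[ℂ] (Fin d → ℂ)) (flagElt F₁ k))
    (hs : ∀ k, k ≤ d → s k ≠ 0 ∧ flagElt (qfMap A F₂) k =
      s k • ExteriorAlgebra.map (A : (Fin d → ℂ) →ₗ[ℂ] (Fin d → ℂ)) (flagElt F₂ k))
    (ht : ∀ k, k ≤ d → t k ≠ 0 ∧ flagElt (qfMap A G) k =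
      t k • ExteriorAlgebra.map (A : (Fin d → ℂ) →ₗ[ℂ] (Fin d → ℂ)) (flagElt G k))
    {a b c : ℕ} (h : a + b + c = d) :
    φ (flagElt (qfMap A F₁) a * flagElt (qfMap A F₂) b * flagElt (qfMap A G) c) =
      δ * r a * s b * t c * φ (flagElt F₁ a * flagElt F₂ b * flagElt G c) := by
  rw [(hr a (by omega)).2, (hs b (by omega)).2, (ht c (by omega)).2]
  simp only [smul_mul_assoc, mul_smul_comm, ← map_mul, map_smul, smul_eq_mul]
  rw [hδ _ (qf_mem_top _ _ _ h)]
  ring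

lemma qfMap_triple {d : ℕ} (φ : ExtAlg d →ₗ[ℂ] ℂ) (hφ : IsTopIso φ)
    (A : (Fin d → ℂ) ≃ₗ[ℂ] (Fin d → ℂ)) (F₁ F₂ G : CompleteFlag d) {j : ℕ × ℕ × ℕ}
    (hj : j ∈ Bset d) :
    tripleRatio φ (qfMap A F₁) (qfMap A F₂) (qfMap A G) j = tripleRatio φ F₁ F₂ G j := by
  obtain ⟨δ, hδ0, hδ⟩ := qfMap_det φ hφ A
  obtain ⟨r, hr⟩ := qfMap_elt A F₁
  obtain ⟨s, hs⟩ := qfMap_elt A F₂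
  obtain ⟨t, ht⟩ := qfMap_elt A G
  obtain ⟨a, b, c⟩ := j
  simp only [Bset, Finset.mem_filter] at hj
  obtain ⟨-, ha, hb, hc, hd⟩ := hj
  obtain ⟨a, rfl⟩ := Nat.exists_eq_succ_of_ne_zero ha.ne'
  obtain ⟨b, rfl⟩ := Nat.exists_eq_succ_of_ne_zero hb.ne'
  obtain ⟨c, rfl⟩ := Nat.exists_eq_succ_of_ne_zero hc.ne'
  simp only [tripleRatio, tripleRatioOf, Nat.succ_eq_add_one, Nat.add_sub_cancel] at *
  rw [qfMap_W φ A hδ hr hs ht (by omega), qfMap_W φ A hδ hr hs ht (by omega),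
    qfMap_W φ A hδ hr hs ht (by omega), qfMap_W φ A hδ hr hs ht (by omega),
    qfMap_W φ A hδ hr hs ht (by omega), qfMap_W φ A hδ hr hs ht (by omega)]
  have hq : δ ^ 3 * r (a + 1 + 1) * r (a + 1) * r a * s (b + 1 + 1) * s (b + 1) * s b *
      t (c + 1 + 1) * t (c + 1) * t c ≠ 0 := by
    have r1 := (hr (a + 1 + 1) (by omega)).1
    have r2 := (hr (a + 1) (by omega)).1
    have r3 := (hr a (by omega)).1
    have s1 := (hs (b + 1 + 1) (by omega)).1
    have s2 := (hs (b + 1) (by omega)).1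
    have s3 := (hs b (by omega)).1
    have t1 := (ht (c + 1 + 1) (by omega)).1
    have t2 := (ht (c + 1) (by omega)).1
    have t3 := (ht c (by omega)).1
    clear hr hs ht
    simp [*]
  symm
  rw [← mul_div_mul_left _ _ hq]
  congr 1 <;> ring

lemma qfMap_double {d : ℕ} (φ : ExtAlg d →ₗ[ℂ] ℂ) (hφ : IsTopIso φ)
    (A : (Fin d → ℂ) ≃ₗ[ℂ] (Fin d → ℂ)) (F₁ F₂ G K : CompleteFlag d) {i : ℕ × ℕ}
    (hi : i ∈ Aset d) :
    doubleRatio φ (qfMap A F₁) (qfMap A F₂) (qfMap A G) (qfMap A K) i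
      = doubleRatio φ F₁ F₂ G K i := by
  obtain ⟨δ, hδ0, hδ⟩ := qfMap_det φ hφ A
  obtain ⟨r, hr⟩ := qfMap_elt A F₁
  obtain ⟨s, hs⟩ := qfMap_elt A F₂
  obtain ⟨t, ht⟩ := qfMap_elt A G
  obtain ⟨u, hu⟩ := qfMap_elt A K
  obtain ⟨a, b⟩ := i
  simp only [Aset, Finset.mem_filter] at hi
  obtain ⟨-, ha, hb, hd⟩ := hi
  obtain ⟨a, rfl⟩ := Nat.exists_eq_succ_of_ne_zero ha.ne'
  obtain ⟨b, rfl⟩ := Nat.exists_eq_succ_of_ne_zero hb.ne'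
  simp only [doubleRatio, doubleRatioOf, Nat.succ_eq_add_one, Nat.add_sub_cancel] at *
  rw [qfMap_W φ A hδ hr hs ht (by omega), qfMap_W φ A hδ hr hs ht (by omega),
    qfMap_W φ A hδ hr hs hu (by omega), qfMap_W φ A hδ hr hs hu (by omega)]
  have hq : δ ^ 2 * r (a + 1) * r a * s (b + 1) * s b * t 1 * u 1 ≠ 0 := by
    have r2 := (hr (a + 1) (by omega)).1
    have r3 := (hr a (by omega)).1
    have s2 := (hs (b + 1) (by omega)).1
    have s3 := (hs b (by omega)).1
    have t2 := (ht 1 (by omega)).1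
    have t3 := (hu 1 (by omega)).1
    clear hr hs ht hu
    simp [*]
  rw [neg_inj]
  symm
  rw [← mul_div_mul_left _ _ hq]
  congr 1 <;> ring

lemma qfMap_genPos {d : ℕ} (A : (Fin d → ℂ) ≃ₗ[ℂ] (Fin d → ℂ)) {F₁ F₂ G : CompleteFlag d}
    (h : GenPos ![F₁, F₂, G]) : GenPos ![qfMap A F₁, qfMap A F₂, qfMap A G] := by
  intro k hk
  have h1 := h k hk
  have h2 := congrArg (Submodule.map (A : (Fin d → ℂ) →ₗ[ℂ] (Fin d → ℂ))) h1
  rw [Submodule.map_iSup] at h2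
  rw [eq_top_iff]
  have h3 : Submodule.map (A : (Fin d → ℂ) →ₗ[ℂ] (Fin d → ℂ)) ⊤ = ⊤ := by simp
  rw [← h3, ← h2]
  refine iSup_mono fun i => ?_
  fin_cases i <;> exact le_rfl

lemma qf_normal {d : ℕ} (hd : 2 ≤ d) {F₁ F₂ G : CompleteFlag d}
    (h : GenPos ![F₁, F₂, G]) : ∃ e : ℕ → (Fin d → ℂ),
      (∀ i, i < d → F₁.space (i + 1) = F₁.space i ⊔ Submodule.span ℂ {e i}) ∧
      (∀ i, i < d → F₂.space (i + 1) = F₂.space i ⊔ Submodule.span ℂ {e (d - 1 - i)}) ∧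
      G.space 1 = Submodule.span ℂ {∑ i ∈ Finset.range d, e i} := by
  obtain ⟨v, hv⟩ : ∃ v, G.space 1 = Submodule.span ℂ {v} := by
    have h1 := G.finrank_eq 1 (by omega)
    obtain ⟨v, hv, hv0⟩ := qf_ex_ne h1
    exact ⟨v, le_antisymm (fun y hy => by
      obtain ⟨c, rfl⟩ := qf_prop h1 hv hv0 hy
      exact Submodule.smul_mem _ _ (Submodule.mem_span_singleton_self v))
      ((Submodule.span_singleton_le_iff_mem _ _).2 hv)⟩
  have hdec : ∀ i, ∃ p : Fin d → ℂ, i ≤ d → p ∈ F₁.space i ∧ v - p ∈ F₂.space (d - i) := by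
    intro i
    by_cases hi : i ≤ d
    swap
    · exact ⟨0, fun h => absurd h hi⟩
    have h1 := qf_sup h (a := i) (b := d - i) (c := 0) (by omega)
    rw [qf_space_zero, sup_bot_eq] at h1
    have h2 : v ∈ F₁.space i ⊔ F₂.space (d - i) := by rw [h1]; trivial
    obtain ⟨p, hp, q, hq, rfl⟩ := Submodule.mem_sup.1 h2
    exact ⟨p, fun _ => ⟨hp, by simpa using hq⟩⟩
  choose p hp using hdec
  have hnot : ∀ i, i < d → v ∉ F₁.space i ⊔ F₂.space (d - 1 - i) := by
    intro i hi hmem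
    have h1 := qf_sup h (a := i) (b := d - 1 - i) (c := 1) (by omega)
    rw [hv, sup_eq_left.2 ((Submodule.span_singleton_le_iff_mem _ _).2 hmem)] at h1
    have h2 := Submodule.finrank_add_le_finrank_add_finrank (F₁.space i) (F₂.space (d - 1 - i))
    rw [h1, F₁.finrank_eq _ (by omega), F₂.finrank_eq _ (by omega), finrank_top] at h2
    simp at h2
    omega
  refine ⟨fun i => p (i + 1) - p i, ?_, ?_, ?_⟩
  · intro i hi
    apply qf_space_succ _ hi
    · exact Submodule.sub_mem _ (hp (i + 1) (by omega)).1
        (F₁.mono (Nat.le_succ i) (hp i (by omega)).1)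
    · intro hmem
      apply hnot i hi
      have h1 : p (i + 1) ∈ F₁.space i := by
        have := Submodule.add_mem _ hmem (hp i (by omega)).1
        simpa using this
      have h2 := (hp (i + 1) (by omega)).2
      have : v = p (i + 1) + (v - p (i + 1)) := by abel
      rw [this]
      refine Submodule.add_mem_sup h1 ?_
      have e : d - (i + 1) = d - 1 - i := by omega
      rwa [← e]
  · intro i' hi'
    obtain ⟨i, hi, rfl⟩ : ∃ i, i < d ∧ i' = d - 1 - i := ⟨d - 1 - i', by omega, by omega⟩
    have e0 : d - 1 - (d - 1 - i) = i := by omega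
    rw [e0]
    have h1 := (hp (i + 1) (by omega)).2
    have h2 := (hp i (by omega)).2
    have e1 : d - (i + 1) = d - 1 - i := by omega
    have e2 : d - i = d - 1 - i + 1 := by omega
    rw [e1] at h1
    rw [e2] at h2
    have e3 : p (i + 1) - p i = (v - p i) - (v - p (i + 1)) := by abel
    beta_reduce
    apply qf_space_succ _ hi'
    · rw [e3]
      exact Submodule.sub_mem _ h2 (F₂.mono (Nat.le_succ _) h1)
    · rw [e3]
      intro hmem
      apply hnot i hi
      have h3 := Submodule.add_mem _ hmem h1
      rw [sub_add_cancel] at h3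
      have : v = p i + (v - p i) := by abel
      rw [this]
      exact Submodule.add_mem_sup (hp i (by omega)).1 h3
  · rw [hv, Finset.sum_range_sub]
    have h1 := (hp d le_rfl).2
    have h2 := (hp 0 (by omega)).1
    rw [Nat.sub_self, qf_space_zero, Submodule.mem_bot, sub_eq_zero] at h1
    rw [qf_space_zero, Submodule.mem_bot] at h2
    rw [← h1, h2, sub_zero]

lemma qf_exists_map {d : ℕ} (hd : 2 ≤ d) {F₁ F₂ G H₁ H₂ K : CompleteFlag d}
    (h : GenPos ![F₁, F₂, G]) (h' : GenPos ![H₁, H₂, K]) :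
    ∃ A : (Fin d → ℂ) ≃ₗ[ℂ] (Fin d → ℂ), qfMap A F₁ = H₁ ∧ qfMap A F₂ = H₂ ∧
      (qfMap A G).space 1 = K.space 1 := by
  have basis : ∀ (F : CompleteFlag d) (e : ℕ → (Fin d → ℂ)),
      (∀ i, i < d → F.space (i + 1) = F.space i ⊔ Submodule.span ℂ {e i}) →
      ∃ b : Module.Basis (Fin d) ℂ (Fin d → ℂ), ∀ i : Fin d, b i = e i := by
    intro F e he
    have hle : ∀ k, k ≤ d → F.space k ≤ Submodule.span ℂ (Set.range fun i : Fin d => e i) := by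
      intro k
      induction k with
      | zero => intro _; rw [qf_space_zero]; exact bot_le
      | succ k ih =>
        intro hk
        rw [he k (by omega)]
        refine sup_le (ih (by omega)) ?_
        rw [Submodule.span_singleton_le_iff_mem]
        exact Submodule.subset_span ⟨⟨k, by omega⟩, rfl⟩
    have htop := hle d le_rfl
    rw [F.eq_top d le_rfl] at htop
    exact ⟨basisOfTopLeSpanOfCardEqFinrank _ htop (by simp), fun i => by simp⟩
  obtain ⟨e, e1, e2, e3⟩ := qf_normal hd h
  obtain ⟨f, f1, f2, f3⟩ := qf_normal hd h'
  obtain ⟨b, hb⟩ := basis F₁ e e1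
  obtain ⟨c, hc⟩ := basis H₁ f f1
  let A := b.equiv c (Equiv.refl _)
  have hA : ∀ i, i < d → A (e i) = f i := by
    intro i hi
    have := b.equiv_apply ⟨i, hi⟩ c (Equiv.refl _)
    rw [hb] at this
    simpa [A, hc] using this
  have gen : ∀ (F H : CompleteFlag d) (e f : ℕ → (Fin d → ℂ)), (∀ i, i < d → A (e i) = f i) →
      (∀ i, i < d → F.space (i + 1) = F.space i ⊔ Submodule.span ℂ {e i}) →
      (∀ i, i < d → H.space (i + 1) = H.space i ⊔ Submodule.span ℂ {f i}) → qfMap A F = H := by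
    intro F H e f hA he hf
    apply qf_ext
    intro k
    induction k with
    | zero => rw [qf_space_zero, qf_space_zero]
    | succ k ih =>
      by_cases hk : k < d
      · rw [hf k hk, ← ih, ← hA k hk]
        change Submodule.map _ _ = Submodule.map _ _ ⊔ _
        rw [he k hk, Submodule.map_sup, Submodule.map_span, Set.image_singleton]
        rfl
      · rw [CompleteFlag.eq_top _ _ (by omega), CompleteFlag.eq_top _ _ (by omega)]
  refine ⟨A, gen F₁ H₁ e f hA e1 f1, gen F₂ H₂ _ _ (fun i hi => hA _ (by omega)) e2 f2, ?_⟩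
  change Submodule.map _ _ = _
  rw [e3, f3, Submodule.map_span, Set.image_singleton]
  congr 2
  change A _ = _
  rw [map_sum]
  exact Finset.sum_congr rfl fun i hi => hA i (Finset.mem_range.1 hi)

/-- Proposition 2.1(2): two quadruples of flags `(F₁,F₂,G₁,G₂)` and
`(H₁,H₂,K₁,K₂)` with `(F₁,F₂,G_k)` and `(H₁,H₂,K_k)` in general position are projectively
equivalent iff they have the same triple ratios and double ratios. -/
theorem quadruples_projectively_equivalent_iff_ratios_eq
    (d : ℕ) (hd : 2 ≤ d) (φ : ExtAlg d →ₗ[ℂ] ℂ) (hφ : IsTopIso φ)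
    (F₁ F₂ G₁ G₂ H₁ H₂ K₁ K₂ : CompleteFlag d)
    (hFG₁ : GenPos ![F₁, F₂, G₁]) (hFG₂ : GenPos ![F₁, F₂, G₂])
    (hHK₁ : GenPos ![H₁, H₂, K₁]) (hHK₂ : GenPos ![H₁, H₂, K₂]) :
    (∃ A : (Fin d → ℂ) ≃ₗ[ℂ] (Fin d → ℂ),
        (∀ k, Submodule.map (A : (Fin d → ℂ) →ₗ[ℂ] (Fin d → ℂ)) (F₁.space k) = H₁.space k) ∧
        (∀ k, Submodule.map (A : (Fin d → ℂ) →ₗ[ℂ] (Fin d → ℂ)) (F₂.space k) = H₂.space k) ∧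
        (∀ k, Submodule.map (A : (Fin d → ℂ) →ₗ[ℂ] (Fin d → ℂ)) (G₁.space k) = K₁.space k) ∧
        (∀ k, Submodule.map (A : (Fin d → ℂ) →ₗ[ℂ] (Fin d → ℂ)) (G₂.space k) = K₂.space k)) ↔
      ((∀ j ∈ Bset d,
          tripleRatio φ F₁ F₂ G₁ j = tripleRatio φ H₁ H₂ K₁ j ∧
          tripleRatio φ F₁ F₂ G₂ j = tripleRatio φ H₁ H₂ K₂ j) ∧
        (∀ i ∈ Aset d, doubleRatio φ F₁ F₂ G₁ G₂ i = doubleRatio φ H₁ H₂ K₁ K₂ i)) := by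
  constructor
  · rintro ⟨A, a1, a2, a3, a4⟩
    obtain rfl : qfMap A F₁ = H₁ := qf_ext a1
    obtain rfl : qfMap A F₂ = H₂ := qf_ext a2
    obtain rfl : qfMap A G₁ = K₁ := qf_ext a3
    obtain rfl : qfMap A G₂ = K₂ := qf_ext a4
    exact ⟨fun j hj => ⟨(qfMap_triple φ hφ A _ _ _ hj).symm, (qfMap_triple φ hφ A _ _ _ hj).symm⟩,
      fun i hi => (qfMap_double φ hφ A _ _ _ _ hi).symm⟩
  · rintro ⟨hT, hD⟩
    obtain ⟨A, rfl, rfl, hA⟩ := qf_exists_map hd hFG₁ hHK₁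
    have g1 := qfMap_genPos A hFG₁
    have g2 := qfMap_genPos A hFG₂
    have h1 : qfMap A G₁ = K₁ := qf_triple φ hφ g1 hHK₁ hA fun j hj => by
      rw [qfMap_triple φ hφ A _ _ _ hj, (hT j hj).1]
    have h2 : (qfMap A G₂).space 1 = K₂.space 1 :=
      qf_double hd φ hφ g1 g2 hHK₂ hA fun i hi => by
        rw [qfMap_double φ hφ A _ _ _ _ hi, hD i hi]
    have h3 : qfMap A G₂ = K₂ := qf_triple φ hφ g2 hHK₂ h2 fun j hj => by
      rw [qfMap_triple φ hφ A _ _ _ hj, (hT j hj).2]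
    subst h1 h3
    exact ⟨A, fun _ => rfl, fun _ => rfl, fun _ => rfl, fun _ => rfl⟩
end

section
/- Let d ≥ 2 be an integer, (F₁,F₂,F₃) a triple of complete flags in ℂ^d in general position, and j=(j₁,j₂,j₃)∈ℬ. Then the triples (F₂,F₃,F₁) and (F₂,F₁,F₃) are also in general position, and the triple ratio satisfies T^{(j₂,j₃,j₁)}(F₂,F₃,F₁) = T^{(j₁,j₂,j₃)}(F₁,F₂,F₃) and T^{(j₂,j₁,j₃)}(F₂,F₁,F₃) = T^{(j₁,j₂,j₃)}(F₁,F₂,F₃)^{−1}. -/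
open scoped BigOperators

theorem aux_genPos_perm {d m : ℕ} (F : Fin m → CompleteFlag d) (e : Equiv.Perm (Fin m))
    (h : GenPos F) : GenPos (F ∘ e) := by
  intro k hk
  have h1 := h (k ∘ e.symm) (by rw [← hk]; exact Equiv.sum_comp e.symm k)
  rw [← h1, ← Equiv.iSup_comp (g := fun i => (F i).space ((k ∘ e.symm) i)) e]
  simp

theorem aux_comm1 {d : ℕ} (v : Fin d → ℂ) (q : ℕ) (y : ExtAlg d)
    (hy : y ∈ (LinearMap.range (ExteriorAlgebra.ι ℂ : (Fin d → ℂ) →ₗ[ℂ] ExtAlg d)) ^ q) :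
    ExteriorAlgebra.ι ℂ v * y = (-1 : ℂ) ^ q • (y * ExteriorAlgebra.ι ℂ v) := by
  induction hy using Submodule.pow_induction_on_left' with
  | algebraMap r => simp [Algebra.commutes]
  | add x y i hx hy ihx ihy => rw [mul_add, ihx, ihy, add_mul, smul_add]
  | mem_mul m hm i x hx ih =>
    obtain ⟨w, rfl⟩ := hm
    have hs : ExteriorAlgebra.ι ℂ v * ExteriorAlgebra.ι ℂ w
        = - (ExteriorAlgebra.ι ℂ w * ExteriorAlgebra.ι ℂ v) :=
      eq_neg_of_add_eq_zero_left (ExteriorAlgebra.ι_add_mul_swap v w)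
    rw [← mul_assoc, hs, neg_mul, mul_assoc, ih, mul_smul_comm, mul_assoc, pow_succ]
    simp

theorem aux_comm {d : ℕ} (p q : ℕ) (x y : ExtAlg d)
    (hx : x ∈ (LinearMap.range (ExteriorAlgebra.ι ℂ : (Fin d → ℂ) →ₗ[ℂ] ExtAlg d)) ^ p)
    (hy : y ∈ (LinearMap.range (ExteriorAlgebra.ι ℂ : (Fin d → ℂ) →ₗ[ℂ] ExtAlg d)) ^ q) :
    x * y = (-1 : ℂ) ^ (p * q) • (y * x) := by
  induction hx using Submodule.pow_induction_on_left' with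
  | algebraMap r => simp [Algebra.commutes]
  | add x z i hx hz ihx ihz => rw [add_mul, ihx, ihz, mul_add, smul_add]
  | mem_mul m hm i x hx ih =>
    obtain ⟨w, rfl⟩ := hm
    rw [mul_assoc, ih, mul_smul_comm, ← mul_assoc, aux_comm1 w q y hy, smul_mul_assoc,
      smul_smul, mul_assoc, ← pow_add]
    congr 2
    rw [Nat.succ_eq_add_one]
    ring

theorem aux_mem {d : ℕ} (F : CompleteFlag d) (k : ℕ) :
    flagElt F k ∈ (LinearMap.range (ExteriorAlgebra.ι ℂ : (Fin d → ℂ) →ₗ[ℂ] ExtAlg d)) ^ k := by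
  unfold flagElt
  split_ifs with h
  · exact pow_le_pow_left' LinearMap.map_le_range k h.choose_spec.1
  · exact zero_mem _

theorem aux_cyc {d : ℕ} (φ : ExtAlg d →ₗ[ℂ] ℂ) (F₁ F₂ F₃ : CompleteFlag d) (p q r : ℕ) :
    φ (flagElt F₂ q * flagElt F₃ r * flagElt F₁ p) =
      (-1 : ℂ) ^ ((q + r) * p) * φ (flagElt F₁ p * flagElt F₂ q * flagElt F₃ r) := by
  rw [aux_comm (q + r) p _ _ (by rw [pow_add]; exact Submodule.mul_mem_mul (aux_mem _ _) (aux_mem _ _))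
    (aux_mem _ _), map_smul, smul_eq_mul, mul_assoc]

theorem aux_swap {d : ℕ} (φ : ExtAlg d →ₗ[ℂ] ℂ) (F₁ F₂ F₃ : CompleteFlag d) (p q r : ℕ) :
    φ (flagElt F₂ q * flagElt F₁ p * flagElt F₃ r) =
      (-1 : ℂ) ^ (q * p) * φ (flagElt F₁ p * flagElt F₂ q * flagElt F₃ r) := by
  rw [aux_comm q p _ _ (aux_mem _ _) (aux_mem _ _), smul_mul_assoc, map_smul, smul_eq_mul]

theorem aux_ratio (u v w u' v' w' A B C A' B' C' : ℂ) (h : u * v * w = u' * v' * w')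
    (h0 : u * v * w ≠ 0) :
    (u * A * (v * B) * (w * C)) / (u' * A' * (v' * B') * (w' * C')) =
      (A * B * C) / (A' * B' * C') := by
  rw [show u * A * (v * B) * (w * C) = (u * v * w) * (A * B * C) by ring,
    show u' * A' * (v' * B') * (w' * C') = (u * v * w) * (A' * B' * C') by rw [h]; ring,
    mul_div_mul_left _ _ h0]

/-- symmetries of the triple ratio under permuting the flags:
cyclically permuting both the flags and the indices preserves `T`, while a transposition
inverts it. -/
theorem tripleRatio_cyclic_and_swap
    (d : ℕ) (hd : 2 ≤ d) (φ : ExtAlg d →ₗ[ℂ] ℂ) (hφ : IsTopIso φ)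
    (F₁ F₂ F₃ : CompleteFlag d) (hF : GenPos ![F₁, F₂, F₃])
    (j : ℕ × ℕ × ℕ) (hj : j ∈ Bset d) :
    GenPos ![F₂, F₃, F₁] ∧ GenPos ![F₂, F₁, F₃] ∧
    tripleRatio φ F₂ F₃ F₁ (j.2.1, j.2.2, j.1) = tripleRatio φ F₁ F₂ F₃ j ∧
    tripleRatio φ F₂ F₁ F₃ (j.2.1, j.1, j.2.2) = (tripleRatio φ F₁ F₂ F₃ j)⁻¹ := by
  obtain ⟨a, b, c⟩ := j
  simp only [Bset, Finset.mem_filter] at hj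
  obtain ⟨-, ha, hb, hc, -⟩ := hj
  obtain ⟨a, rfl⟩ : ∃ n, a = n + 1 := ⟨a - 1, by omega⟩
  obtain ⟨b, rfl⟩ : ∃ n, b = n + 1 := ⟨b - 1, by omega⟩
  obtain ⟨c, rfl⟩ : ∃ n, c = n + 1 := ⟨c - 1, by omega⟩
  refine ⟨?_, ?_, ?_, ?_⟩
  · have h := aux_genPos_perm _ (finRotate 3) hF
    convert h using 1
    ext i : 1
    fin_cases i <;> rfl
  · have h := aux_genPos_perm _ (Equiv.swap (0 : Fin 3) 1) hF
    convert h using 1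
    ext i : 1
    fin_cases i <;> rfl
  · simp only [tripleRatio, tripleRatioOf, Nat.add_sub_cancel, aux_cyc φ F₁ F₂ F₃]
    rw [aux_ratio]
    · congr 1 <;> ring
    · simp only [← pow_add]
      ring_nf
    · simp
  · simp only [tripleRatio, tripleRatioOf, Nat.add_sub_cancel, aux_swap φ F₁ F₂ F₃]
    rw [aux_ratio, inv_div]
    · congr 1 <;> ring
    · simp only [← pow_add]
      ring_nf
    · simp
end
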